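/- F[V]^{SL2(F_p)} is generated as an F-algebra by its homogeneous elements of degree at most β(p), where β(p) = p² − p + 4 if p ≡ −1 (mod 3) and β(p) = (p² − p + 12)/3 if p ≡ 1 (mod 3). In particular the Noether number of F[V]^{SL2(F_p)} is bounded above by β(p). -/

import Mathlib

open MvPolynomial

noncomputable section

/-- The right action of the 2×2 matrix `g` over `F_p` on `F[V] = F[a₃,a₂,a₁,a₀]`
(with `aᵢ = X i`), given by the dual of the third symmetric power representation. -/
def act (p : ℕ) [Fact p.Prime] (F : Type) [Field F] [CharP F p]
    (g : Matrix (Fin 2) (Fin 2) (ZMod p)) :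
    MvPolynomial (Fin 4) F →ₐ[F] MvPolynomial (Fin 4) F :=
  letI c : ZMod p → MvPolynomial (Fin 4) F := fun x => C (ZMod.castHom (dvd_refl p) F x)
  letI al := c (g 0 0)
  letI be := c (g 0 1)
  letI ga := c (g 1 0)
  letI de := c (g 1 1)
  aeval ![
    de ^ 3 * X 0 + 3 * de ^ 2 * ga * X 1 + 3 * de * ga ^ 2 * X 2 + ga ^ 3 * X 3,
    de ^ 2 * be * X 0 + (de ^ 2 * al + 2 * de * be * ga) * X 1
      + (2 * de * ga * al + be * ga ^ 2) * X 2 + ga ^ 2 * al * X 3,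
    de * be ^ 2 * X 0 + (2 * de * be * al + be ^ 2 * ga) * X 1
      + (de * al ^ 2 + 2 * be * ga * al) * X 2 + ga * al ^ 2 * X 3,
    be ^ 3 * X 0 + 3 * be ^ 2 * al * X 1 + 3 * be * al ^ 2 * X 2 + al ^ 3 * X 3]

/-- The transfer with respect to the Sylow `p`-subgroup `P = ⟨σ⟩`,
`tr^P(f) = ∑_{τ ∈ P} (f)τ`, where the elements of `P` are the matrices `[[1,s],[0,1]]`. -/
def trP (p : ℕ) [Fact p.Prime] (F : Type) [Field F] [CharP F p]
    (f : MvPolynomial (Fin 4) F) : MvPolynomial (Fin 4) F :=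
  ∑ s : ZMod p, act p F !![1, s; 0, 1] f

/-- The relative transfer `tr_B^G(f) = ∑_{τ ∈ Q ∪ {η}} (f)τ`, using the coset
representatives `Q ∪ {η}` of the Borel subgroup `B` in `G = SL₂(F_p)`. -/
def trBG (p : ℕ) [Fact p.Prime] (F : Type) [Field F] [CharP F p]
    (f : MvPolynomial (Fin 4) F) : MvPolynomial (Fin 4) F :=
  (∑ s : ZMod p, act p F !![1, 0; s, 1] f) + act p F !![0, 1; -1, 0] f

/-- The full transfer `tr^G(f) = ∑_{τ ∈ SL₂(F_p)} (f)τ`. -/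
def trG (p : ℕ) [Fact p.Prime] (F : Type) [Field F] [CharP F p]
    (f : MvPolynomial (Fin 4) F) : MvPolynomial (Fin 4) F :=
  ∑ g : Matrix.SpecialLinearGroup (Fin 2) (ZMod p), act p F g.1 f

/-- `N = ∏_{τ ∈ P} (a₃)τ = ∏_{s ∈ F_p} (a₃ + 3s a₂ + 3s² a₁ + s³ a₀)`. -/
def Npoly (p : ℕ) [Fact p.Prime] (F : Type) [Field F] [CharP F p] :
    MvPolynomial (Fin 4) F :=
  ∏ s : ZMod p, act p F !![1, s; 0, 1] (X 3)

/-- The weight of the monomial `a₃^e₃ a₂^e₂ a₁^e₁ a₀^e₀`, i.e. `3e₃ + e₂ - e₁ - 3e₀`. -/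
def wt (d : Fin 4 →₀ ℕ) : ℤ :=
  3 * (d 3 : ℤ) + (d 2 : ℤ) - (d 1 : ℤ) - 3 * (d 0 : ℤ)

/-- `f` is isobaric of weight `lam` modulo `p - 1`: every monomial occurring in `f`
has weight congruent to `lam` modulo `p - 1`. -/
def Isobaric (p : ℕ) {F : Type} [Field F] (f : MvPolynomial (Fin 4) F) (lam : ℤ) : Prop :=
  ∀ d ∈ f.support, ((p : ℤ) - 1) ∣ (wt d - lam)

/-- Strict grevlex comparison on exponent vectors, for the graded reverse
lexicographic order with `a₀ < a₁ < a₂ < a₃`. -/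
def grevlexLt (d e : Fin 4 →₀ ℕ) : Prop :=
  (∑ i : Fin 4, d i) < (∑ i : Fin 4, e i) ∨
    ((∑ i : Fin 4, d i) = (∑ i : Fin 4, e i) ∧
      ∃ k : Fin 4, e k < d k ∧ ∀ j : Fin 4, j < k → d j = e j)

/-- `d` is the lead monomial of `f` in the grevlex order with `a₀ < a₁ < a₂ < a₃`. -/
def LeadMonomialIs {F : Type} [Field F] (f : MvPolynomial (Fin 4) F) (d : Fin 4 →₀ ℕ) : Prop :=
  coeff d f ≠ 0 ∧ ∀ e ∈ f.support, e ≠ d → grevlexLt e d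

/-- The lead term of `f` is `c · x^d` in the grevlex order with `a₀ < a₁ < a₂ < a₃`. -/
def LeadTermIs {F : Type} [Field F] (f : MvPolynomial (Fin 4) F) (c : F) (d : Fin 4 →₀ ℕ) :
    Prop :=
  LeadMonomialIs f d ∧ coeff d f = c

/-- The discriminant `D` of the binary cubic. -/
def Dpoly (F : Type) [Field F] : MvPolynomial (Fin 4) F :=
  3 * X 2 ^ 2 * X 1 ^ 2 - 4 * X 3 * X 1 ^ 3 - 4 * X 2 ^ 3 * X 0
    + 6 * X 3 * X 2 * X 1 * X 0 - X 3 ^ 2 * X 0 ^ 2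

/-- `K = -tr^G(a₁^{p-1})`. -/
def Kpoly (p : ℕ) [Fact p.Prime] (F : Type) [Field F] [CharP F p] :
    MvPolynomial (Fin 4) F :=
  - trG p F (X 1 ^ (p - 1))

/-- Dickson's invariant `L = 3(a₂^p a₁ - a₂ a₁^p) - (a₃^p a₀ - a₃ a₀^p)`. -/
def Lpoly (p : ℕ) (F : Type) [Field F] : MvPolynomial (Fin 4) F :=
  3 * (X 2 ^ p * X 1 - X 2 * X 1 ^ p) - (X 3 ^ p * X 0 - X 3 * X 0 ^ p)

/-- `e = 2a₁³ + a₀(a₃a₀ - 3a₂a₁)`. -/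
def epoly (F : Type) [Field F] : MvPolynomial (Fin 4) F :=
  2 * X 1 ^ 3 + X 0 * (X 3 * X 0 - 3 * X 2 * X 1)

/-- `d = a₁² - a₂a₀`. -/
def dpoly (F : Type) [Field F] : MvPolynomial (Fin 4) F :=
  X 1 ^ 2 - X 2 * X 0

/-- `ξ = 3a₂² - 4a₃a₁`. -/
def xipoly (F : Type) [Field F] : MvPolynomial (Fin 4) F :=
  3 * X 2 ^ 2 - 4 * X 3 * X 1

/-- The ring of `SL₂(F_p)`-invariants `F[V]^{SL₂(F_p)}`, as a subalgebra of `F[V]`. -/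
def invariants (p : ℕ) [Fact p.Prime] (F : Type) [Field F] [CharP F p] :
    Subalgebra F (MvPolynomial (Fin 4) F) where
  carrier := {f | ∀ g : Matrix.SpecialLinearGroup (Fin 2) (ZMod p), act p F g.1 f = f}
  mul_mem' := fun hf hg g => by rw [map_mul, hf g, hg g]
  one_mem' := fun g => map_one _
  add_mem' := fun hf hg g => by rw [map_add, hf g, hg g]
  zero_mem' := fun g => map_zero _
  algebraMap_mem' := fun c g => (act _ _ _).commutes c

section Helpers

variable (p : ℕ) [Fact p.Prime] (F : Type) [Field F] [CharP F p]

/-- The embedding of the prime field. -/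
def iota : ZMod p →+* F := ZMod.castHom (dvd_refl p) F

/-- Evaluation of the generic cubic at the vector `(x,y)`. -/
def lin (x y : ZMod p) : MvPolynomial (Fin 4) F :=
  C (iota p F y) ^ 3 * X 0 + 3 * C (iota p F y) ^ 2 * C (iota p F x) * X 1
    + 3 * C (iota p F y) * C (iota p F x) ^ 2 * X 2 + C (iota p F x) ^ 3 * X 3

lemma act_X0 (g : Matrix (Fin 2) (Fin 2) (ZMod p)) :
    act p F g (X 0) = C (iota p F (g 1 1)) ^ 3 * X 0
      + 3 * C (iota p F (g 1 1)) ^ 2 * C (iota p F (g 1 0)) * X 1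
      + 3 * C (iota p F (g 1 1)) * C (iota p F (g 1 0)) ^ 2 * X 2
      + C (iota p F (g 1 0)) ^ 3 * X 3 := by
  simp [act, iota]

lemma act_X1 (g : Matrix (Fin 2) (Fin 2) (ZMod p)) :
    act p F g (X 1) = C (iota p F (g 1 1)) ^ 2 * C (iota p F (g 0 1)) * X 0
      + (C (iota p F (g 1 1)) ^ 2 * C (iota p F (g 0 0))
        + 2 * C (iota p F (g 1 1)) * C (iota p F (g 0 1)) * C (iota p F (g 1 0))) * X 1
      + (2 * C (iota p F (g 1 1)) * C (iota p F (g 1 0)) * C (iota p F (g 0 0))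
        + C (iota p F (g 0 1)) * C (iota p F (g 1 0)) ^ 2) * X 2
      + C (iota p F (g 1 0)) ^ 2 * C (iota p F (g 0 0)) * X 3 := by
  simp [act, iota]

lemma act_X2 (g : Matrix (Fin 2) (Fin 2) (ZMod p)) :
    act p F g (X 2) = C (iota p F (g 1 1)) * C (iota p F (g 0 1)) ^ 2 * X 0
      + (2 * C (iota p F (g 1 1)) * C (iota p F (g 0 1)) * C (iota p F (g 0 0))
        + C (iota p F (g 0 1)) ^ 2 * C (iota p F (g 1 0))) * X 1
      + (C (iota p F (g 1 1)) * C (iota p F (g 0 0)) ^ 2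
        + 2 * C (iota p F (g 0 1)) * C (iota p F (g 1 0)) * C (iota p F (g 0 0))) * X 2
      + C (iota p F (g 1 0)) * C (iota p F (g 0 0)) ^ 2 * X 3 := by
  simp [act, iota]

lemma act_X3 (g : Matrix (Fin 2) (Fin 2) (ZMod p)) :
    act p F g (X 3) = C (iota p F (g 0 1)) ^ 3 * X 0
      + 3 * C (iota p F (g 0 1)) ^ 2 * C (iota p F (g 0 0)) * X 1
      + 3 * C (iota p F (g 0 1)) * C (iota p F (g 0 0)) ^ 2 * X 2
      + C (iota p F (g 0 0)) ^ 3 * X 3 := by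
  simp [act, iota]

lemma act_C (g : Matrix (Fin 2) (Fin 2) (ZMod p)) (c : F) :
    act p F g (C c) = C c := (act p F g).commutes c

lemma act_mul (g h : Matrix (Fin 2) (Fin 2) (ZMod p)) (f : MvPolynomial (Fin 4) F) :
    act p F h (act p F g f) = act p F (g * h) f := by
  have : (act p F h).comp (act p F g) = act p F (g * h) := by
    apply MvPolynomial.algHom_ext
    intro i
    rw [AlgHom.comp_apply]
    fin_cases i
    · change act p F h (act p F g (X 0)) = act p F (g * h) (X 0)
      simp only [act_X0, map_add, map_mul, map_pow, act_C, act_X1, act_X2, act_X3, map_ofNat,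
        Matrix.mul_apply, Fin.sum_univ_two]
      ring
    · change act p F h (act p F g (X 1)) = act p F (g * h) (X 1)
      simp only [act_X0, map_add, map_mul, map_pow, act_C, act_X1, act_X2, act_X3, map_ofNat,
        Matrix.mul_apply, Fin.sum_univ_two]
      ring
    · change act p F h (act p F g (X 2)) = act p F (g * h) (X 2)
      simp only [act_X0, map_add, map_mul, map_pow, act_C, act_X1, act_X2, act_X3, map_ofNat,
        Matrix.mul_apply, Fin.sum_univ_two]
      ring
    · change act p F h (act p F g (X 3)) = act p F (g * h) (X 3)
      simp only [act_X0, map_add, map_mul, map_pow, act_C, act_X1, act_X2, act_X3, map_ofNat,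
        Matrix.mul_apply, Fin.sum_univ_two]
      ring
  exact DFunLike.congr_fun this f

lemma act_one (f : MvPolynomial (Fin 4) F) : act p F 1 f = f := by
  have : act p F 1 = AlgHom.id F _ := by
    apply MvPolynomial.algHom_ext
    intro i
    fin_cases i
    · change act p F 1 (X 0) = X 0
      simp [act_X0]
    · change act p F 1 (X 1) = X 1
      simp [act_X1]
    · change act p F 1 (X 2) = X 2
      simp [act_X2]
    · change act p F 1 (X 3) = X 3
      simp [act_X3]
  rw [this]; rfl

lemma act_X0_lin (g : Matrix (Fin 2) (Fin 2) (ZMod p)) :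
    act p F g (X 0) = lin p F (g 1 0) (g 1 1) := act_X0 p F g

lemma act_X3_lin (g : Matrix (Fin 2) (Fin 2) (ZMod p)) :
    act p F g (X 3) = lin p F (g 0 0) (g 0 1) := act_X3 p F g

lemma act_lin (g : Matrix (Fin 2) (Fin 2) (ZMod p)) (x y : ZMod p) :
    act p F g (lin p F x y) = lin p F (x * g 0 0 + y * g 1 0) (x * g 0 1 + y * g 1 1) := by
  simp only [lin, map_add, map_mul, map_pow, act_C, act_X0, act_X1, act_X2, act_X3, map_ofNat]
  ring

lemma lin_smul (c x y : ZMod p) :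
    lin p F (c * x) (c * y) = C (iota p F c) ^ 3 * lin p F x y := by
  simp only [lin, map_mul]
  ring

lemma lin_01 : lin p F 0 1 = X 0 := by simp [lin]
lemma lin_10 : lin p F 1 0 = X 3 := by simp [lin]

lemma isHomog_CX (c : F) (i : Fin 4) : (C c * X i : MvPolynomial (Fin 4) F).IsHomogeneous 1 := by
  simpa using (isHomogeneous_C (Fin 4) c).mul (isHomogeneous_X F i)

lemma act_isHomogeneous (g : Matrix (Fin 2) (Fin 2) (ZMod p)) {f : MvPolynomial (Fin 4) F} {n : ℕ}
    (hf : f.IsHomogeneous n) : (act p F g f).IsHomogeneous n := by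
  have key : ∀ c0 c1 c2 c3 : F, (C c0 * X 0 + C c1 * X 1 + C c2 * X 2 + C c3 * X 3 :
      MvPolynomial (Fin 4) F).IsHomogeneous 1 := fun c0 c1 c2 c3 =>
    (((isHomog_CX F c0 0).add (isHomog_CX F c1 1)).add (isHomog_CX F c2 2)).add (isHomog_CX F c3 3)
  have h := hf.aeval (fun i => act p F g (X i)) (n := 1) (by
    intro i
    fin_cases i
    · change (act p F g (X 0)).IsHomogeneous 1
      rw [act_X0]
      convert key ((iota p F (g 1 1)) ^ 3) (3 * (iota p F (g 1 1)) ^ 2 * (iota p F (g 1 0)))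
        (3 * (iota p F (g 1 1)) * (iota p F (g 1 0)) ^ 2) ((iota p F (g 1 0)) ^ 3) using 1
      simp only [map_mul, map_pow, map_ofNat]
    · change (act p F g (X 1)).IsHomogeneous 1
      rw [act_X1]
      convert key ((iota p F (g 1 1)) ^ 2 * (iota p F (g 0 1)))
        ((iota p F (g 1 1)) ^ 2 * (iota p F (g 0 0))
        + 2 * (iota p F (g 1 1)) * (iota p F (g 0 1)) * (iota p F (g 1 0)))
        (2 * (iota p F (g 1 1)) * (iota p F (g 1 0)) * (iota p F (g 0 0))
        + (iota p F (g 0 1)) * (iota p F (g 1 0)) ^ 2)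
        ((iota p F (g 1 0)) ^ 2 * (iota p F (g 0 0))) using 1
      simp only [map_mul, map_pow, map_ofNat, map_add]
    · change (act p F g (X 2)).IsHomogeneous 1
      rw [act_X2]
      convert key ((iota p F (g 1 1)) * (iota p F (g 0 1)) ^ 2)
        (2 * (iota p F (g 1 1)) * (iota p F (g 0 1)) * (iota p F (g 0 0))
        + (iota p F (g 0 1)) ^ 2 * (iota p F (g 1 0)))
        ((iota p F (g 1 1)) * (iota p F (g 0 0)) ^ 2
        + 2 * (iota p F (g 0 1)) * (iota p F (g 1 0)) * (iota p F (g 0 0)))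
        ((iota p F (g 1 0)) * (iota p F (g 0 0)) ^ 2) using 1
      simp only [map_mul, map_pow, map_ofNat, map_add]
    · change (act p F g (X 3)).IsHomogeneous 1
      rw [act_X3]
      convert key ((iota p F (g 0 1)) ^ 3) (3 * (iota p F (g 0 1)) ^ 2 * (iota p F (g 0 0)))
        (3 * (iota p F (g 0 1)) * (iota p F (g 0 0)) ^ 2) ((iota p F (g 0 0)) ^ 3) using 1
      simp only [map_mul, map_pow, map_ofNat])
  rw [one_mul] at h
  have e : aeval (fun i => act p F g (X i)) = act p F g := by
    apply MvPolynomial.algHom_ext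
    intro i
    simp
  rwa [e] at h

lemma hc_mul_aux {r : MvPolynomial (Fin 4) F} {i : ℕ} (hr : r.IsHomogeneous i) (n : ℕ)
    (y : MvPolynomial (Fin 4) F) :
    homogeneousComponent n (r * y) = ∑ j ∈ Finset.range (y.totalDegree + 1),
      if i + j = n then r * homogeneousComponent j y else 0 := by
  conv_lhs => rw [← sum_homogeneousComponent y]
  rw [Finset.mul_sum, map_sum]
  refine Finset.sum_congr rfl fun j _ => ?_
  rw [homogeneousComponent_of_mem (hr.mul (homogeneousComponent_isHomogeneous j y))]
  simp only [eq_comm]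

lemma hc_mul_left {r : MvPolynomial (Fin 4) F} {i : ℕ} (hr : r.IsHomogeneous i) (n : ℕ)
    (hin : i ≤ n) (y : MvPolynomial (Fin 4) F) :
    homogeneousComponent n (r * y) = r * homogeneousComponent (n - i) y := by
  rw [hc_mul_aux F hr]
  have : ∀ j, (i + j = n) = (n - i = j) := by intro j; apply propext; omega
  simp only [this, Finset.sum_ite_eq]
  split_ifs with h
  · rfl
  · rw [homogeneousComponent_eq_zero, mul_zero]
    simp only [Finset.mem_range, not_lt] at h
    omega

lemma hc_mul_left_zero {r : MvPolynomial (Fin 4) F} {i : ℕ} (hr : r.IsHomogeneous i) (n : ℕ)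
    (hin : n < i) (y : MvPolynomial (Fin 4) F) :
    homogeneousComponent n (r * y) = 0 := by
  rw [hc_mul_aux F hr]
  apply Finset.sum_eq_zero
  intro j _
  rw [if_neg (by omega)]

lemma hc_act (g : Matrix (Fin 2) (Fin 2) (ZMod p)) (n : ℕ) (f : MvPolynomial (Fin 4) F) :
    homogeneousComponent n (act p F g f) = act p F g (homogeneousComponent n f) := by
  conv_lhs => rw [← sum_homogeneousComponent f]
  rw [map_sum, map_sum]
  have : ∀ i, homogeneousComponent n (act p F g (homogeneousComponent i f))
      = if i = n then act p F g (homogeneousComponent n f) else 0 := by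
    intro i
    rw [homogeneousComponent_of_mem
      (act_isHomogeneous p F g (homogeneousComponent_isHomogeneous i f))]
    split_ifs with h1 h2 h2
    · rw [h1]
    · exact absurd h1.symm h2
    · exact absurd h2.symm h1
    · rfl
  simp only [this]
  rw [Finset.sum_ite_eq']
  split_ifs with h
  · rfl
  · rw [homogeneousComponent_eq_zero, map_zero]
    simpa using h

end Helpers

section Cosets

variable (p : ℕ) [Fact p.Prime] (F : Type) [Field F] [CharP F p]

lemma mem_inv {f : MvPolynomial (Fin 4) F} : f ∈ invariants p F ↔
    ∀ g : Matrix (Fin 2) (Fin 2) (ZMod p), g.det = 1 → act p F g f = f :=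
  ⟨fun h g hg => h ⟨g, hg⟩, fun h g => h g.1 g.2⟩

/-- Invariance under the Sylow subgroup. -/
def PInv (h : MvPolynomial (Fin 4) F) : Prop := ∀ s : ZMod p, act p F !![1, s; 0, 1] h = h

variable {p F}

lemma PInv.mul {f g : MvPolynomial (Fin 4) F} (hf : PInv p F f) (hg : PInv p F g) :
    PInv p F (f * g) := fun s => by rw [map_mul, hf s, hg s]

lemma PInv.add {f g : MvPolynomial (Fin 4) F} (hf : PInv p F f) (hg : PInv p F g) :
    PInv p F (f + g) := fun s => by rw [map_add, hf s, hg s]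

lemma PInv.sub {f g : MvPolynomial (Fin 4) F} (hf : PInv p F f) (hg : PInv p F g) :
    PInv p F (f - g) := fun s => by rw [map_sub, hf s, hg s]

lemma PInv.neg {f : MvPolynomial (Fin 4) F} (hf : PInv p F f) :
    PInv p F (-f) := fun s => by rw [map_neg, hf s]

lemma PInv.pow {f : MvPolynomial (Fin 4) F} (hf : PInv p F f) (n : ℕ) :
    PInv p F (f ^ n) := fun s => by rw [map_pow, hf s]

lemma PInv.C (c : F) : PInv p F (MvPolynomial.C c) := fun s => act_C p F _ c

lemma PInv.zero : PInv p F 0 := fun s => map_zero _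

lemma PInv.of_inv {f : MvPolynomial (Fin 4) F} (hf : f ∈ invariants p F) : PInv p F f :=
  fun s => (mem_inv p F).1 hf _ (by simp [Matrix.det_fin_two])

lemma PInv.hc {f : MvPolynomial (Fin 4) F} (hf : PInv p F f) (n : ℕ) :
    PInv p F (homogeneousComponent n f) := fun s => by rw [← hc_act, hf s]

lemma PInv.of_mul {f g : MvPolynomial (Fin 4) F} (hf : PInv p F f) (hf0 : f ≠ 0)
    (h : PInv p F (f * g)) : PInv p F g := fun s => by
  have := h s
  rw [map_mul, hf s] at this
  exact mul_left_cancel₀ hf0 this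

lemma PInv.X0 : PInv p F (X 0) := fun s => by simp [act_X0]

lemma inv_hc {f : MvPolynomial (Fin 4) F} (hf : f ∈ invariants p F) (n : ℕ) :
    homogeneousComponent n f ∈ invariants p F := by
  rw [mem_inv] at *
  intro g hg
  rw [← hc_act, hf g hg]

lemma trP_add (f g : MvPolynomial (Fin 4) F) : trP p F (f + g) = trP p F f + trP p F g := by
  simp [trP, Finset.sum_add_distrib]

lemma trP_sub (f g : MvPolynomial (Fin 4) F) : trP p F (f - g) = trP p F f - trP p F g := by
  simp [trP, Finset.sum_sub_distrib]

lemma trP_neg (f : MvPolynomial (Fin 4) F) : trP p F (-f) = - trP p F f := by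
  simp [trP]

lemma trP_zero : trP p F (0 : MvPolynomial (Fin 4) F) = 0 := by
  simp [trP]

lemma trP_sum {ι : Type*} (S : Finset ι) (f : ι → MvPolynomial (Fin 4) F) :
    trP p F (∑ i ∈ S, f i) = ∑ i ∈ S, trP p F (f i) := by
  simp only [trP, map_sum]
  rw [Finset.sum_comm]

lemma trP_mul {h : MvPolynomial (Fin 4) F} (hh : PInv p F h) (c : MvPolynomial (Fin 4) F) :
    trP p F (h * c) = h * trP p F c := by
  simp only [trP, map_mul, hh _, Finset.mul_sum]

lemma trP_inv (c : MvPolynomial (Fin 4) F) : PInv p F (trP p F c) := by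
  intro t
  simp only [trP, map_sum, act_mul]
  apply Fintype.sum_equiv (Equiv.addRight t)
  intro s
  simp [Matrix.mul_fin_two, add_comm]

lemma trP_hc (c : MvPolynomial (Fin 4) F) (n : ℕ) :
    trP p F (homogeneousComponent n c) = homogeneousComponent n (trP p F c) := by
  simp only [trP, map_sum, hc_act]

lemma act_eq_of_row {h : MvPolynomial (Fin 4) F} (hh : PInv p F h)
    {A B : Matrix (Fin 2) (Fin 2) (ZMod p)} (hA : A.det = 1) (hB : B.det = 1)
    (h0 : A 1 0 = B 1 0) (h1 : A 1 1 = B 1 1) : act p F A h = act p F B h := by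
  rw [Matrix.det_fin_two] at hA hB
  have : A = !![1, A 0 1 * B 0 0 - A 0 0 * B 0 1; 0, 1] * B := by
    ext i j
    rw [h0, h1] at hA
    fin_cases i <;> fin_cases j <;> simp [Matrix.mul_apply, Fin.sum_univ_two]
    · linear_combination (B 0 0) * hA - (A 0 0) * hB
    · linear_combination (B 0 1) * hA - (A 0 1) * hB
    · exact h0
    · exact h1
  rw [this, ← act_mul, hh]

variable (p) in
/-- A determinant one matrix with prescribed second row. -/
def gv (v : ZMod p × ZMod p) : Matrix (Fin 2) (Fin 2) (ZMod p) :=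
  if v.2 = 0 then !![0, -v.1⁻¹; v.1, 0] else !![v.2⁻¹, 0; v.1, v.2]

lemma gv_10 (v : ZMod p × ZMod p) : gv p v 1 0 = v.1 := by
  unfold gv; split_ifs <;> simp

lemma gv_11 (v : ZMod p × ZMod p) : gv p v 1 1 = v.2 := by
  unfold gv; split_ifs with h <;> simp [h]

lemma gv_det {v : ZMod p × ZMod p} (hv : v ≠ 0) : (gv p v).det = 1 := by
  unfold gv
  split_ifs with h
  · have : v.1 ≠ 0 := fun h' => hv (Prod.ext h' h)
    simp [Matrix.det_fin_two, this]
  · simp [Matrix.det_fin_two, h]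

/-- Relative transfer from the Sylow subgroup. -/
def PiT (h : MvPolynomial (Fin 4) F) : MvPolynomial (Fin 4) F :=
  ∑ v ∈ Finset.univ.erase (0 : ZMod p × ZMod p), act p F (gv p v) h

variable (p) in
lemma PiT_add (f g : MvPolynomial (Fin 4) F) :
    PiT (p := p) (f + g) = PiT (p := p) f + PiT (p := p) g := by
  simp [PiT, Finset.sum_add_distrib]

variable (p) in
lemma PiT_neg (f : MvPolynomial (Fin 4) F) :
    PiT (p := p) (-f) = - PiT (p := p) f := by
  simp [PiT]

lemma PiT_mul {r : MvPolynomial (Fin 4) F} (hr : r ∈ invariants p F)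
    (h : MvPolynomial (Fin 4) F) : PiT (p := p) (r * h) = r * PiT (p := p) h := by
  rw [mem_inv] at hr
  rw [PiT, PiT, Finset.mul_sum]
  refine Finset.sum_congr rfl fun v hv => ?_
  rw [map_mul, hr _ (gv_det (Finset.ne_of_mem_erase hv))]

lemma PiT_inv_neg {f : MvPolynomial (Fin 4) F} (hf : f ∈ invariants p F) :
    PiT (p := p) f = -f := by
  rw [mem_inv] at hf
  have : ∀ v ∈ Finset.univ.erase (0 : ZMod p × ZMod p), act p F (gv p v) f = f :=
    fun v hv => hf _ (gv_det (Finset.ne_of_mem_erase hv))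
  rw [PiT, Finset.sum_congr rfl this, Finset.sum_const, Finset.card_erase_of_mem (Finset.mem_univ _)]
  rw [Finset.card_univ, Fintype.card_prod, ZMod.card]
  have hp : 0 < p := (Fact.out : p.Prime).pos
  rw [nsmul_eq_mul, Nat.cast_sub (Nat.mul_pos hp hp)]
  simp

lemma PiT_hc (c : MvPolynomial (Fin 4) F) (n : ℕ) :
    PiT (p := p) (homogeneousComponent n c) = homogeneousComponent n (PiT (p := p) c) := by
  simp only [PiT, map_sum, hc_act]

lemma PiT_homog {h : MvPolynomial (Fin 4) F} {n : ℕ} (hh : h.IsHomogeneous n) :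
    (PiT (p := p) h).IsHomogeneous n :=
  IsHomogeneous.sum _ _ _ fun _ _ => act_isHomogeneous p F _ hh

lemma PiT_mem {h : MvPolynomial (Fin 4) F} (hh : PInv p F h) :
    PiT (p := p) h ∈ invariants p F := by
  rw [mem_inv]
  intro A hA
  have hA' := hA
  rw [Matrix.det_fin_two] at hA'
  simp only [PiT, map_sum, act_mul]
  let B : Matrix (Fin 2) (Fin 2) (ZMod p) := !![A 1 1, - A 0 1; - A 1 0, A 0 0]
  let φ : (Matrix (Fin 2) (Fin 2) (ZMod p)) → ZMod p × ZMod p → ZMod p × ZMod p :=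
    fun A v => (v.1 * A 0 0 + v.2 * A 1 0, v.1 * A 0 1 + v.2 * A 1 1)
  have hBA : ∀ v, φ B (φ A v) = v := by
    intro v
    refine Prod.ext ?_ ?_ <;> simp [φ, B]
    · linear_combination v.1 * hA'
    · linear_combination v.2 * hA'
  have hAB : ∀ v, φ A (φ B v) = v := by
    intro v
    refine Prod.ext ?_ ?_ <;> simp [φ, B]
    · linear_combination v.1 * hA'
    · linear_combination v.2 * hA'
  have h0 : ∀ A, φ A 0 = 0 := by intro A; simp [φ]
  have hA0 : ∀ v, v ≠ 0 → φ A v ≠ 0 := by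
    intro v hv h
    apply hv
    rw [← hBA v, h, h0]
  refine Finset.sum_bij' (fun v _ => φ A v) (fun v _ => φ B v) ?_ ?_ (fun v _ => hBA v)
    (fun v _ => hAB v) ?_
  · intro v hv
    exact Finset.mem_erase.2 ⟨hA0 v (Finset.ne_of_mem_erase hv), Finset.mem_univ _⟩
  · intro v hv
    refine Finset.mem_erase.2 ⟨?_, Finset.mem_univ _⟩
    intro h
    apply Finset.ne_of_mem_erase hv
    rw [← hAB v, h, h0]
  · intro v hv
    have hv0 := Finset.ne_of_mem_erase hv
    apply act_eq_of_row hh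
    · rw [Matrix.det_mul, gv_det hv0, hA, one_mul]
    · exact gv_det (hA0 v hv0)
    · rw [gv_10, Matrix.mul_apply, Fin.sum_univ_two, gv_10, gv_11]
    · rw [gv_11, Matrix.mul_apply, Fin.sum_univ_two, gv_10, gv_11]

lemma trG_eq (c : MvPolynomial (Fin 4) F) : trG p F c = PiT (p := p) (trP p F c) := by
  symm
  simp only [trG, PiT, trP, map_sum, act_mul]
  rw [← Finset.sum_product']
  refine Finset.sum_bij (fun vs hvs => (⟨!![1, vs.2; 0, 1] * gv p vs.1, ?_⟩ :
    Matrix.SpecialLinearGroup (Fin 2) (ZMod p))) ?_ ?_ ?_ ?_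
  · rw [Matrix.det_mul, gv_det (Finset.ne_of_mem_erase (Finset.mem_product.1 hvs).1)]
    simp [Matrix.det_fin_two]
  · intro _ _; exact Finset.mem_univ _
  · rintro ⟨v, s⟩ hv ⟨w, t⟩ hw h
    have hv0 := Finset.ne_of_mem_erase (Finset.mem_product.1 hv).1
    have h := congrArg Subtype.val h
    simp only at h hv0
    have e0 := congrFun (congrFun h 1) 0
    have e1 := congrFun (congrFun h 1) 1
    simp [Matrix.mul_apply, Fin.sum_univ_two, gv_10, gv_11] at e0 e1
    have hvw : v = w := Prod.ext e0 e1
    subst hvw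
    refine Prod.ext rfl ?_
    have f0 := congrFun (congrFun h 0) 0
    have f1 := congrFun (congrFun h 0) 1
    simp [Matrix.mul_apply, Fin.sum_univ_two, gv_10, gv_11] at f0 f1
    by_contra hne
    have : ¬ (s = t) := hne
    apply hv0
    exact Prod.ext (f0.resolve_left this) (f1.resolve_left this)
  · rintro ⟨A, hA⟩ -
    have hA' := hA
    rw [Matrix.det_fin_two] at hA'
    have hv0 : ((A 1 0, A 1 1) : ZMod p × ZMod p) ≠ 0 := by
      intro h
      rw [Prod.ext_iff] at h
      simp at h
      simp [h.1, h.2] at hA'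
    have hB := gv_det hv0
    rw [Matrix.det_fin_two, gv_10, gv_11] at hB
    set B := gv p (A 1 0, A 1 1) with hBdef
    refine ⟨((A 1 0, A 1 1), A 0 1 * B 0 0 - A 0 0 * B 0 1), ?_, ?_⟩
    · simpa using hv0
    · apply Subtype.ext
      simp only
      ext i j
      fin_cases i <;> fin_cases j <;>
        simp [Matrix.mul_apply, Fin.sum_univ_two, ← hBdef]
      · rw [hBdef, gv_10, ← hBdef]; simp only at hB; linear_combination (-B 0 0) * hA' + (A 0 0) * hB
      · rw [hBdef, gv_11, ← hBdef]; simp only at hB; linear_combination (-B 0 1) * hA' + (A 0 1) * hB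
      · rw [hBdef, gv_10]
      · rw [hBdef, gv_11]
  · intro _ _; rfl

lemma trG_mem (c : MvPolynomial (Fin 4) F) : trG p F c ∈ invariants p F := by
  rw [trG_eq]; exact PiT_mem (trP_inv c)

lemma trG_add (f g : MvPolynomial (Fin 4) F) : trG p F (f + g) = trG p F f + trG p F g := by
  simp [trG, Finset.sum_add_distrib]

lemma trG_smul (c : F) (f : MvPolynomial (Fin 4) F) : trG p F (c • f) = c • trG p F f := by
  simp [trG, Finset.smul_sum]

lemma trG_mul {r : MvPolynomial (Fin 4) F} (hr : r ∈ invariants p F)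
    (h : MvPolynomial (Fin 4) F) : trG p F (r * h) = r * trG p F h := by
  rw [trG, trG, Finset.mul_sum]
  refine Finset.sum_congr rfl fun v hv => ?_
  rw [map_mul, hr v]

lemma trG_act {g : Matrix (Fin 2) (Fin 2) (ZMod p)} (hg : g.det = 1)
    (f : MvPolynomial (Fin 4) F) : trG p F (act p F g f) = trG p F f := by
  simp only [trG, act_mul]
  let g' : Matrix.SpecialLinearGroup (Fin 2) (ZMod p) := ⟨g, hg⟩
  have h1 : ∀ h : Matrix.SpecialLinearGroup (Fin 2) (ZMod p),
      act p F (g * h.1) f = act p F (g' * h).1 f := fun h => rfl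
  simp only [h1]
  exact Equiv.sum_comp (Equiv.mulLeft g')
    (fun h : Matrix.SpecialLinearGroup (Fin 2) (ZMod p) => act p F h.1 f)

lemma trG_homog {h : MvPolynomial (Fin 4) F} {n : ℕ} (hh : h.IsHomogeneous n) :
    (trG p F h).IsHomogeneous n :=
  IsHomogeneous.sum _ _ _ fun _ _ => act_isHomogeneous p F _ hh

lemma trP_one_zero : trP p F 1 = 0 := by
  simp [trP, ZMod.card]

lemma trG_C (c : F) : trG p F (C c) = 0 := by
  rw [trG_eq]
  have : trP p F (C c) = 0 := by
    have h := trP_mul (PInv.C (p := p) c) 1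
    rwa [mul_one, trP_one_zero, mul_zero] at h
  rw [this]
  simp [PiT]

/-- Decomposition of the relative transfer. -/
lemma PiT_split (h : MvPolynomial (Fin 4) F) : PiT (p := p) h =
    (∑ y ∈ Finset.univ.erase (0 : ZMod p), act p F (gv p (0, y)) h)
    + ∑ x ∈ Finset.univ.erase (0 : ZMod p), ∑ y : ZMod p, act p F (gv p (x, y)) h := by
  have h1 : (Finset.univ.erase (0 : ZMod p × ZMod p)) =
      (({0} : Finset (ZMod p)) ×ˢ Finset.univ.erase (0 : ZMod p)) ∪
      (Finset.univ.erase (0 : ZMod p) ×ˢ Finset.univ) := by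
    ext ⟨x, y⟩
    simp [Prod.ext_iff]
    tauto
  rw [PiT, h1, Finset.sum_union]
  · rw [Finset.sum_product, Finset.sum_product]
    simp
  · rw [Finset.disjoint_left]
    rintro ⟨x, y⟩ h2 h3
    rw [Finset.mem_product] at h2 h3
    exact Finset.ne_of_mem_erase h3.1 (Finset.mem_singleton.1 h2.1)

lemma PiT_torus {h : MvPolynomial (Fin 4) F}
    (hT : ∀ w : ZMod p, w ≠ 0 → act p F !![w, 0; 0, w⁻¹] h = h) : PiT (p := p) h =
    -h + ∑ x ∈ Finset.univ.erase (0 : ZMod p), ∑ y : ZMod p, act p F (gv p (x, y)) h := by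
  rw [PiT_split]
  congr 1
  have : ∀ y ∈ Finset.univ.erase (0 : ZMod p), act p F (gv p (0, y)) h = h := by
    intro y hy
    have hy0 := Finset.ne_of_mem_erase hy
    have := hT y⁻¹ (inv_ne_zero hy0)
    rw [inv_inv] at this
    rw [gv, if_neg hy0]
    exact this
  rw [Finset.sum_congr rfl this, Finset.sum_const, Finset.card_erase_of_mem (Finset.mem_univ _),
    Finset.card_univ, ZMod.card, nsmul_eq_mul, Nat.cast_sub (Fact.out : p.Prime).one_le]
  simp

lemma sum_gv_trP {h : MvPolynomial (Fin 4) F} (hh : PInv p F h) {x : ZMod p} (hx : x ≠ 0) :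
    ∑ y : ZMod p, act p F (gv p (x, y)) h = trP p F (act p F (gv p (x, 0)) h) := by
  rw [trP]
  symm
  apply Fintype.sum_equiv (Equiv.mulLeft₀ x hx)
  intro s
  rw [act_mul]
  have h1 : ∀ y : ZMod p, (x, y) ≠ (0 : ZMod p × ZMod p) := by
    intro y h; exact hx (congrArg Prod.fst h)
  apply act_eq_of_row hh
  · rw [Matrix.det_mul, gv_det (h1 0)]; simp [Matrix.det_fin_two]
  · exact gv_det (h1 _)
  · simp [Matrix.mul_apply, Fin.sum_univ_two, gv_10, gv_11]
  · simp [Matrix.mul_apply, Fin.sum_univ_two, gv_10, gv_11]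

/-- For torus-invariant `h` the relative transfer is `-h` plus a trace. -/
lemma PiT_torus_trP {h : MvPolynomial (Fin 4) F} (hh : PInv p F h)
    (hT : ∀ w : ZMod p, w ≠ 0 → act p F !![w, 0; 0, w⁻¹] h = h) : PiT (p := p) h =
    -h + trP p F (∑ x ∈ Finset.univ.erase (0 : ZMod p), act p F (gv p (x, 0)) h) := by
  rw [PiT_torus hT, trP_sum]
  rw [Finset.sum_congr rfl fun x hx => sum_gv_trP hh (Finset.ne_of_mem_erase hx)]

end Cosets

section Invs

variable {p : ℕ} [Fact p.Prime] {F : Type} [Field F] [CharP F p]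

variable (p) in
lemma iota_pow_card (s : ZMod p) : iota p F s ^ p = iota p F s := by
  rw [← map_pow, ZMod.pow_card]

variable (p) in
/-- `f` is a weight vector for the torus. -/
def Wt (m : ℤ) (f : MvPolynomial (Fin 4) F) : Prop :=
  ∀ w : ZMod p, w ≠ 0 → act p F !![w, 0; 0, w⁻¹] f = C (iota p F w ^ m) * f

lemma iota_ne {w : ZMod p} (hw : w ≠ 0) : iota p F w ≠ 0 :=
  (map_ne_zero _).2 hw

lemma Wt.mul {m n : ℤ} {f g : MvPolynomial (Fin 4) F} (hf : Wt p m f) (hg : Wt p n g) :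
    Wt p (m + n) (f * g) := fun w hw => by
  rw [map_mul, hf w hw, hg w hw, zpow_add₀ (iota_ne hw), map_mul]; ring

lemma Wt.add {m : ℤ} {f g : MvPolynomial (Fin 4) F} (hf : Wt p m f) (hg : Wt p m g) :
    Wt p m (f + g) := fun w hw => by
  rw [map_add, hf w hw, hg w hw]; ring

lemma Wt.sub {m : ℤ} {f g : MvPolynomial (Fin 4) F} (hf : Wt p m f) (hg : Wt p m g) :
    Wt p m (f - g) := fun w hw => by
  rw [map_sub, hf w hw, hg w hw]; ring

lemma Wt.const (c : F) : Wt p 0 (MvPolynomial.C c : MvPolynomial (Fin 4) F) := fun w hw => by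
  rw [act_C]; simp

lemma Wt.nat (c : ℕ) [c.AtLeastTwo] : Wt p 0 (OfNat.ofNat c : MvPolynomial (Fin 4) F) := fun w hw => by
  rw [map_ofNat]; simp

lemma Wt.pow {m : ℤ} {f : MvPolynomial (Fin 4) F} (hf : Wt p m f) (n : ℕ) :
    Wt p (n * m) (f ^ n) := by
  induction n with
  | zero => intro w hw; simp
  | succ n ih =>
    rw [pow_succ]
    convert ih.mul hf using 1
    push_cast; ring

lemma Wt.congr {m n : ℤ} {f : MvPolynomial (Fin 4) F} (hf : Wt p m f)
    (h : ((p : ℤ) - 1) ∣ m - n) : Wt p n f := fun w hw => by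
  rw [hf w hw]
  obtain ⟨k, hk⟩ := h
  have : m = n + (p - 1) * k := by linarith
  rw [this, zpow_add₀ (iota_ne hw), zpow_mul]
  have h1 : iota p F w ^ ((p : ℤ) - 1) = 1 := by
    rw [zpow_sub₀ (iota_ne hw), zpow_natCast, iota_pow_card, zpow_one, div_self (iota_ne hw)]
  rw [h1, one_zpow, mul_one]

lemma Wt.zero_inv {f : MvPolynomial (Fin 4) F} (hf : Wt p 0 f) :
    ∀ w : ZMod p, w ≠ 0 → act p F !![w, 0; 0, w⁻¹] f = f := fun w hw => by
  rw [hf w hw]; simp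

lemma Wt.X0 : Wt p (-3) (X 0 : MvPolynomial (Fin 4) F) := fun w hw => by
  have : iota p F w ^ (-3 : ℤ) = (iota p F w)⁻¹ ^ 3 := by
    rw [zpow_neg, ← inv_zpow]; norm_cast
  rw [act_X0, this, map_pow]
  simp

lemma Wt.X1 : Wt p (-1) (X 1 : MvPolynomial (Fin 4) F) := fun w hw => by
  have h2 := iota_ne (F := F) hw
  have : iota p F w ^ (-1 : ℤ) = (iota p F w)⁻¹ ^ 2 * iota p F w := by
    rw [zpow_neg]; field_simp
  rw [act_X1, this, map_mul, map_pow]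
  simp

lemma Wt.X2 : Wt p 1 (X 2 : MvPolynomial (Fin 4) F) := fun w hw => by
  have h2 := iota_ne (F := F) hw
  have : iota p F w ^ (1 : ℤ) = (iota p F w)⁻¹ * iota p F w ^ 2 := by
    field_simp
  rw [act_X2, this, map_mul, map_pow]
  simp

lemma Wt.X3 : Wt p 3 (X 3 : MvPolynomial (Fin 4) F) := fun w hw => by
  rw [act_X3]
  simp

lemma inv_of_gens {f : MvPolynomial (Fin 4) F} (h1 : PInv p F f) (h2 : Wt p 0 f)
    (h3 : act p F !![0, 1; -1, 0] f = f) : f ∈ invariants p F := by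
  rw [mem_inv]
  intro A hA
  by_cases hx : A 1 0 = 0
  · have hA' := hA
    rw [Matrix.det_fin_two, hx, mul_zero, sub_zero] at hA'
    have hy : A 1 1 ≠ 0 := right_ne_zero_of_mul_eq_one hA'
    rw [act_eq_of_row h1 hA (B := !![(A 1 1)⁻¹, 0; 0, ((A 1 1)⁻¹)⁻¹])]
    · exact h2.zero_inv _ (inv_ne_zero hy)
    · simp [Matrix.det_fin_two, hy]
    · simp [hx]
    · simp
  · rw [act_eq_of_row h1 hA (B := !![0, 1; -1, 0] * !![-(A 1 0), 0; 0, (-(A 1 0))⁻¹]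
      * !![1, A 1 1 / A 1 0; 0, 1])]
    · rw [← act_mul, ← act_mul, h3, h2.zero_inv _ (neg_ne_zero.2 hx), h1]
    · rw [Matrix.det_mul, Matrix.det_mul]; simp [Matrix.det_fin_two, hx]
    · simp
    · simp; field_simp

lemma Npoly_eq : Npoly p F = ∏ s : ZMod p, lin p F 1 s := by
  rw [Npoly]
  refine Finset.prod_congr rfl fun s _ => ?_
  rw [act_X3_lin]; simp

lemma act_N (g : Matrix (Fin 2) (Fin 2) (ZMod p)) : act p F g (Npoly p F) =
    ∏ s : ZMod p, lin p F (g 0 0 + s * g 1 0) (g 0 1 + s * g 1 1) := by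
  rw [Npoly_eq, map_prod]
  refine Finset.prod_congr rfl fun s _ => ?_
  rw [act_lin, one_mul, one_mul]

lemma act_N' (a b c d : ZMod p) : act p F !![a, b; c, d] (Npoly p F) =
    ∏ s : ZMod p, lin p F (a + s * c) (b + s * d) := act_N _

lemma N_PInv : PInv p F (Npoly p F) := by
  intro t
  rw [act_N, Npoly_eq]
  apply Fintype.prod_equiv (Equiv.addLeft t)
  intro s
  simp

lemma N_Wt : Wt p 3 (Npoly p F) := by
  intro w hw
  rw [act_N', Npoly_eq]
  have : ∀ s : ZMod p, lin p F (w + s * 0) (0 + s * w⁻¹)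
      = C (iota p F w) ^ 3 * lin p F 1 (w⁻¹ * w⁻¹ * s) := by
    intro s
    rw [← lin_smul]
    simp
    congr 1
    field_simp
  rw [Finset.prod_congr rfl fun s _ => this s, Finset.prod_mul_distrib, Finset.prod_const,
    Finset.card_univ, ZMod.card]
  have e1 : ((C (iota p F w) : MvPolynomial (Fin 4) F) ^ 3) ^ p = C (iota p F w ^ (3 : ℤ)) := by
    have : iota p F w ^ (3 : ℤ) = iota p F w ^ 3 := by norm_cast
    rw [← pow_mul, mul_comm, pow_mul, ← map_pow, iota_pow_card, ← map_pow, this]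
  have hw2 : w⁻¹ * w⁻¹ ≠ 0 := mul_ne_zero (inv_ne_zero hw) (inv_ne_zero hw)
  have e2 : ∏ s : ZMod p, lin p F 1 (w⁻¹ * w⁻¹ * s) = ∏ s : ZMod p, lin p F 1 s :=
    Equiv.prod_comp (Equiv.mulLeft₀ _ hw2) (fun s => lin p F 1 s)
  rw [e1, e2]

lemma lin_homog (x y : ZMod p) : (lin p F x y).IsHomogeneous 1 := by
  have key : ∀ c0 c1 c2 c3 : F, (C c0 * X 0 + C c1 * X 1 + C c2 * X 2 + C c3 * X 3 :
      MvPolynomial (Fin 4) F).IsHomogeneous 1 := fun c0 c1 c2 c3 =>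
    (((isHomog_CX F c0 0).add (isHomog_CX F c1 1)).add (isHomog_CX F c2 2)).add (isHomog_CX F c3 3)
  have := key (iota p F y ^ 3) (3 * iota p F y ^ 2 * iota p F x) (3 * iota p F y * iota p F x ^ 2)
    (iota p F x ^ 3)
  simpa only [lin, map_mul, map_pow, map_ofNat] using this

lemma N_homog : (Npoly p F).IsHomogeneous p := by
  rw [Npoly_eq]
  have := IsHomogeneous.prod (Finset.univ : Finset (ZMod p)) (fun s => lin p F 1 s) (fun _ => 1)
    (fun s _ => lin_homog 1 s)
  simpa [ZMod.card] using this

variable (p F) in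
/-- The product of all lines. -/
def Theta : MvPolynomial (Fin 4) F := X 0 * Npoly p F

lemma Theta_homog : (Theta p F).IsHomogeneous (p + 1) := by
  rw [add_comm]; exact (isHomogeneous_X F 0).mul N_homog

lemma prod_nonzero : ∏ s ∈ Finset.univ.erase (0 : ZMod p), s = -1 := by
  have := ZMod.wilsons_lemma p
  rw [← ZMod.wilsons_lemma p, ← Finset.prod_range_add_one_eq_factorial]
  have hp := (Fact.out : p.Prime)
  rw [Nat.cast_prod]
  symm
  refine Finset.prod_bij (fun i _ => ((i + 1 : ℕ) : ZMod p)) ?_ ?_ ?_ ?_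
  · intro i hi
    rw [Finset.mem_range] at hi
    refine Finset.mem_erase.2 ⟨?_, Finset.mem_univ _⟩
    rw [Ne, ZMod.natCast_eq_zero_iff]
    intro hd
    have := Nat.le_of_dvd (by omega) hd
    omega
  · intro i hi j hj h
    rw [Finset.mem_range] at hi hj
    rw [ZMod.natCast_eq_natCast_iff'] at h
    rw [Nat.mod_eq_of_lt (by omega), Nat.mod_eq_of_lt (by omega)] at h
    omega
  · intro b hb
    have hb0 := Finset.ne_of_mem_erase hb
    have h1 : b.val ≠ 0 := by rwa [Ne, ZMod.val_eq_zero]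
    have h2 := ZMod.val_lt b
    refine ⟨b.val - 1, ?_, ?_⟩
    · rw [Finset.mem_range]; omega
    · rw [Nat.sub_add_cancel (by omega)]; exact ZMod.natCast_zmod_val b
  · intro i hi; rfl

lemma act_eta_N : act p F !![0, 1; -1, 0] (Npoly p F) * X 3 = - (X 0 * Npoly p F) := by
  rw [act_N', Npoly_eq, ← Finset.mul_prod_erase _ _ (Finset.mem_univ (0 : ZMod p)),
    ← Finset.mul_prod_erase _ (fun s => lin p F 1 s) (Finset.mem_univ (0 : ZMod p))]
  have h1 : ∀ s ∈ Finset.univ.erase (0 : ZMod p), lin p F (0 + s * -1) (1 + s * 0)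
      = C (iota p F (-s)) ^ 3 * lin p F 1 (-s⁻¹) := by
    intro s hs
    have hs0 := Finset.ne_of_mem_erase hs
    rw [← lin_smul]
    simp [hs0]
  have h2 : ∏ s ∈ Finset.univ.erase (0 : ZMod p), lin p F 1 (-s⁻¹)
      = ∏ s ∈ Finset.univ.erase (0 : ZMod p), lin p F 1 s := by
    refine Finset.prod_bij' (fun s _ => -s⁻¹) (fun s _ => -s⁻¹) ?_ ?_ ?_ ?_ ?_
    · intro s hs; simpa using hs
    · intro s hs; simpa using hs
    · intro s hs; simp
    · intro s hs; simp
    · intro s hs; rfl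
  have h3 : ∏ s ∈ Finset.univ.erase (0 : ZMod p), (C (iota p F (-s)) ^ 3 : MvPolynomial (Fin 4) F)
      = -1 := by
    rw [Finset.prod_pow]
    have : ∏ s ∈ Finset.univ.erase (0 : ZMod p), (C (iota p F (-s)) : MvPolynomial (Fin 4) F)
      = -1 := by
      rw [← map_prod, ← map_prod]
      have : ∏ s ∈ Finset.univ.erase (0 : ZMod p), (-s) = -1 := by
        rw [← prod_nonzero]
        refine Finset.prod_bij' (fun s _ => -s) (fun s _ => -s) ?_ ?_ ?_ ?_ ?_
        · intro s hs; simpa using hs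
        · intro s hs; simpa using hs
        · intro s hs; simp
        · intro s hs; simp
        · intro s hs; rfl
      rw [this]; simp
    rw [this]; ring
  rw [Finset.prod_congr rfl h1, Finset.prod_mul_distrib, h2, h3, lin_10]
  have : lin p F (0 + 0 * -1) (1 + 0 * 0) = X 0 := by
    simp [lin_01]
  rw [this]
  ring

lemma Theta_inv : Theta p F ∈ invariants p F := by
  apply inv_of_gens
  · exact PInv.X0.mul N_PInv
  · exact (Wt.X0.mul N_Wt).congr (by norm_num)
  · rw [Theta, map_mul, act_X0]
    have := act_eta_N (p := p) (F := F)
    simp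
    linear_combination -this

lemma D_inv : Dpoly F ∈ invariants p F := by
  apply inv_of_gens
  · intro s
    simp only [Dpoly, map_add, map_sub, map_mul, map_pow, map_ofNat, act_X0, act_X1, act_X2, act_X3]
    simp
    ring
  · rw [Dpoly]
    refine Wt.sub (Wt.add (Wt.sub (Wt.sub ?_ ?_) ?_) ?_) ?_
    · exact (((Wt.nat 3).mul (Wt.X2.pow 2)).mul (Wt.X1.pow 2)).congr (by norm_num)
    · exact (((Wt.nat 4).mul Wt.X3).mul (Wt.X1.pow 3)).congr (by norm_num)
    · exact (((Wt.nat 4).mul (Wt.X2.pow 3)).mul Wt.X0).congr (by norm_num)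
    · exact (((((Wt.nat 6).mul Wt.X3).mul Wt.X2).mul Wt.X1).mul Wt.X0).congr (by norm_num)
    · exact ((Wt.X3.pow 2).mul (Wt.X0.pow 2)).congr (by norm_num)
  · simp only [Dpoly, map_add, map_sub, map_mul, map_pow, map_ofNat, act_X0, act_X1, act_X2, act_X3]
    simp
    ring

lemma hom_nat (c : ℕ) [c.AtLeastTwo] :
    (OfNat.ofNat c : MvPolynomial (Fin 4) F).IsHomogeneous 0 := by
  have := isHomogeneous_C (Fin 4) (OfNat.ofNat c : F)
  rwa [map_ofNat] at this

lemma D_homog : (Dpoly F).IsHomogeneous 4 := by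
  rw [Dpoly]
  have h := isHomogeneous_X (σ := Fin 4) F
  refine IsHomogeneous.sub (IsHomogeneous.add (IsHomogeneous.sub (IsHomogeneous.sub ?_ ?_) ?_) ?_) ?_
  · exact ((hom_nat 3).mul ((h 2).pow 2)).mul ((h 1).pow 2)
  · exact ((hom_nat 4).mul (h 3)).mul ((h 1).pow 3)
  · exact ((hom_nat 4).mul ((h 2).pow 3)).mul (h 0)
  · exact ((((hom_nat 6).mul (h 3)).mul (h 2)).mul (h 1)).mul (h 0)
  · exact ((h 3).pow 2).mul ((h 0).pow 2)

lemma e_PInv : PInv p F (epoly F) := by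
  intro s
  simp only [epoly, map_add, map_sub, map_mul, map_pow, map_ofNat, act_X0, act_X1, act_X2, act_X3]
  simp
  ring

lemma d_PInv : PInv p F (dpoly F) := by
  intro s
  simp only [dpoly, map_add, map_sub, map_mul, map_pow, map_ofNat, act_X0, act_X1, act_X2, act_X3]
  simp
  ring

lemma e_Wt : Wt p (-3) (epoly F) := by
  rw [epoly]
  have : (2 * X 1 ^ 3 + X 0 * (X 3 * X 0 - 3 * X 2 * X 1) : MvPolynomial (Fin 4) F) =
    2 * X 1 ^ 3 + (X 0 * (X 3 * X 0) - X 0 * (3 * X 2 * X 1)) := by ring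
  rw [this]
  refine Wt.add ?_ (Wt.sub ?_ ?_)
  · exact ((Wt.nat 2).mul (Wt.X1.pow 3)).congr (by norm_num)
  · exact (Wt.X0.mul (Wt.X3.mul Wt.X0)).congr (by norm_num)
  · exact (Wt.X0.mul (((Wt.nat 3).mul Wt.X2).mul Wt.X1)).congr (by norm_num)

lemma e_homog : (epoly F).IsHomogeneous 3 := by
  rw [epoly]
  have h := isHomogeneous_X (σ := Fin 4) F
  refine IsHomogeneous.add ?_ ?_
  · exact (hom_nat 2).mul ((h 1).pow 3)
  · exact (h 0).mul (IsHomogeneous.sub (show IsHomogeneous _ (1 + 1) from (h 3).mul (h 0))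
      (show IsHomogeneous _ (0 + 1 + 1) from ((hom_nat 3).mul (h 2)).mul (h 1)))

lemma L_homog : (Lpoly p F).IsHomogeneous (p + 1) := by
  rw [Lpoly]
  have h := isHomogeneous_X (σ := Fin 4) F
  have h1 : ∀ i j, (X i ^ p * X j : MvPolynomial (Fin 4) F).IsHomogeneous (p + 1) := fun i j => by
    have := ((h i).pow p).mul (h j)
    rwa [one_mul] at this
  have h2 : ∀ i j, (X i * X j ^ p : MvPolynomial (Fin 4) F).IsHomogeneous (p + 1) := fun i j => by
    rw [mul_comm]; exact h1 j i
  refine IsHomogeneous.sub ?_ ((h1 3 0).sub (h2 3 0))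
  have := (hom_nat 3).mul ((h1 2 1).sub (h2 2 1))
  rwa [zero_add] at this

lemma L_inv (hp : 3 < p) : Lpoly p F ∈ invariants p F := by
  have hodd : Odd p := (Fact.out : p.Prime).odd_of_ne_two (by omega)
  have hs : ∀ s : ZMod p, (C (iota p F s) : MvPolynomial (Fin 4) F) ^ p = C (iota p F s) := by
    intro s; rw [← map_pow, iota_pow_card]
  have h2 : (2 : MvPolynomial (Fin 4) F) ^ p = 2 := by
    have := hs 2
    simpa only [map_ofNat] using this
  have h3 : (3 : MvPolynomial (Fin 4) F) ^ p = 3 := by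
    have := hs 3
    simpa only [map_ofNat] using this
  apply inv_of_gens
  · intro s
    simp only [Lpoly, map_add, map_sub, map_mul, map_pow, map_ofNat, act_X0, act_X1, act_X2, act_X3]
    simp [add_pow_char, mul_pow, hs, h2, h3]
    have e2 : (C (iota p F s) ^ 2 : MvPolynomial (Fin 4) F) ^ p = C (iota p F s) ^ 2 := by
      rw [← pow_mul, mul_comm, pow_mul, hs]
    have e3 : (C (iota p F s) ^ 3 : MvPolynomial (Fin 4) F) ^ p = C (iota p F s) ^ 3 := by
      rw [← pow_mul, mul_comm, pow_mul, hs]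
    rw [e2, e3]
    ring
  · rw [Lpoly]
    have a1 : Wt p 0 (X 2 ^ p * X 1 : MvPolynomial (Fin 4) F) :=
      ((Wt.X2.pow p).mul Wt.X1).congr (by ring_nf; rw [add_comm, ← sub_eq_add_neg])
    have a2 : Wt p 0 (X 2 * X 1 ^ p : MvPolynomial (Fin 4) F) :=
      (Wt.X2.mul (Wt.X1.pow p)).congr ⟨-1, by ring⟩
    have a3 : Wt p 0 (X 3 ^ p * X 0 : MvPolynomial (Fin 4) F) :=
      ((Wt.X3.pow p).mul Wt.X0).congr ⟨3, by ring⟩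
    have a4 : Wt p 0 (X 3 * X 0 ^ p : MvPolynomial (Fin 4) F) :=
      (Wt.X3.mul (Wt.X0.pow p)).congr ⟨-3, by ring⟩
    exact Wt.sub (((Wt.nat 3).mul (a1.sub a2)).congr (by norm_num)) (a3.sub a4)
  · simp only [Lpoly, map_add, map_sub, map_mul, map_pow, map_ofNat, act_X0, act_X1, act_X2, act_X3]
    simp [hodd.neg_pow]
    ring_nf
    simp [hodd.neg_pow]
    ring

variable (p F) in
/-- The invariant of degree `p - 1`. -/
def Kp : MvPolynomial (Fin 4) F := PiT (p := p) (X 0 ^ (p - 1))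

lemma Kp_inv : Kp p F ∈ invariants p F := PiT_mem (PInv.X0.pow _)

lemma Kp_homog : (Kp p F).IsHomogeneous (p - 1) := by
  have := PiT_homog (p := p) ((isHomogeneous_X F (0 : Fin 4)).pow (p - 1))
  rwa [one_mul] at this

lemma iota_pow_sub_one {x : ZMod p} (hx : x ≠ 0) : iota p F x ^ (p - 1) = 1 := by
  rw [← map_pow, ZMod.pow_card_sub_one_eq_one hx, map_one]

lemma Kp_eq : Kp p F = - X 0 ^ (p - 1) - trP p F (X 3 ^ (p - 1)) := by
  have hp := (Fact.out : p.Prime).one_le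
  rw [Kp, PiT_torus_trP (PInv.X0.pow _) ((Wt.X0.pow (p-1)).congr (n := 0)
    ⟨-3, by push_cast [hp]; ring⟩).zero_inv]
  have : ∀ x ∈ Finset.univ.erase (0 : ZMod p), act p F (gv p (x, 0)) (X 0 ^ (p - 1))
      = X 3 ^ (p - 1) := by
    intro x hx
    have hx0 := Finset.ne_of_mem_erase hx
    rw [map_pow, act_X0, gv_10, gv_11]
    simp only [map_zero]
    have : (C (iota p F x) ^ 3 : MvPolynomial (Fin 4) F) ^ (p - 1) = 1 := by
      rw [← pow_mul, mul_comm, pow_mul, ← map_pow, iota_pow_sub_one hx0]; simp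
    have e : ∀ z : MvPolynomial (Fin 4) F, 0 ^ 3 * X 0 + 3 * 0 ^ 2 * z * X 1 + 3 * 0 * z ^ 2 * X 2
      + z ^ 3 * X 3 = z ^ 3 * X 3 := by intro z; ring
    rw [e, mul_pow, this, one_mul]
  rw [Finset.sum_congr rfl this, Finset.sum_const, Finset.card_erase_of_mem (Finset.mem_univ _),
    Finset.card_univ, ZMod.card, nsmul_eq_mul, Nat.cast_sub hp]
  simp only [CharP.cast_eq_zero, zero_sub, Nat.cast_one, neg_mul, one_mul]
  rw [trP_neg]
  ring

lemma X0_dvd_act_N {g : Matrix (Fin 2) (Fin 2) (ZMod p)} (hx : g 1 0 ≠ 0) :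
    X 0 ∣ act p F g (Npoly p F) := by
  rw [act_N]
  refine dvd_trans ?_ (Finset.dvd_prod_of_mem _ (Finset.mem_univ (- (g 0 0 / g 1 0))))
  have : g 0 0 + -(g 0 0 / g 1 0) * g 1 0 = 0 := by field_simp; ring
  rw [this]
  simp [lin]

/-- Lemma G. -/
lemma PiT_dvd {h : MvPolynomial (Fin 4) F} (hN : Npoly p F ∣ h) (hT : Wt p 0 h) :
    X 0 ∣ PiT (p := p) h + h := by
  rw [PiT_torus hT.zero_inv]
  have : ∀ a b : MvPolynomial (Fin 4) F, -a + b + a = b := by intros; ring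
  rw [this]
  refine Finset.dvd_sum fun x hx => Finset.dvd_sum fun y _ => ?_
  refine dvd_trans (X0_dvd_act_N ?_) (map_dvd (act p F (gv p (x, y))) hN)
  rw [gv_10]; exact Finset.ne_of_mem_erase hx

end Invs

section Traces

variable {p : ℕ} [Fact p.Prime] {F : Type} [Field F] [CharP F p]

variable (F) in
/-- Setting `X 0 = 0`. -/
def phi : MvPolynomial (Fin 4) F →ₐ[F] MvPolynomial (Fin 4) F := aeval ![0, X 1, X 2, X 3]

@[simp] lemma phi_X0 : phi F (X 0) = 0 := by simp [phi]
@[simp] lemma phi_X1 : phi F (X 1) = X 1 := by simp [phi]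
@[simp] lemma phi_X2 : phi F (X 2) = X 2 := by simp [phi]
@[simp] lemma phi_X3 : phi F (X 3) = X 3 := by simp [phi]
@[simp] lemma phi_C (c : F) : phi F (C c) = C c := (phi F).commutes c

lemma sub_phi_dvd (f : MvPolynomial (Fin 4) F) : X 0 ∣ f - phi F f := by
  induction f using MvPolynomial.induction_on with
  | C a => simp
  | add f g hf hg =>
    have : f + g - phi F (f + g) = (f - phi F f) + (g - phi F g) := by rw [map_add]; ring
    rw [this]; exact dvd_add hf hg
  | mul_X f i hf =>
    have : f * X i - phi F (f * X i) = (f - phi F f) * X i + phi F f * (X i - phi F (X i)) := by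
      rw [map_mul]; ring
    rw [this]
    refine dvd_add (hf.mul_right _) (Dvd.dvd.mul_left ?_ _)
    fin_cases i <;> simp

lemma dvd_of_phi {f g : MvPolynomial (Fin 4) F} (h : phi F f = phi F g) : X 0 ∣ f - g := by
  have h1 := dvd_sub (sub_phi_dvd f) (sub_phi_dvd g)
  rw [h] at h1
  convert h1 using 1
  ring

variable (p F) in
/-- Embedding of the prime field in the polynomial ring. -/
def cs : ZMod p →+* MvPolynomial (Fin 4) F := (C : F →+* MvPolynomial (Fin 4) F).comp (iota p F)

lemma sum_cs_lt {j : ℕ} (h : j < p - 1) : ∑ s : ZMod p, (cs p F s) ^ j = 0 := by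
  simp_rw [← map_pow, ← map_sum]
  rw [FiniteField.sum_pow_lt_card_sub_one (ZMod p) j (by rwa [ZMod.card]), map_zero]

lemma sum_cs_eq (hp : 3 < p) : ∑ s : ZMod p, (cs p F s) ^ (p - 1) = -1 := by
  simp_rw [← map_pow, ← map_sum]
  have : ∑ s : ZMod p, s ^ (p - 1) = -1 := by
    rw [← Finset.add_sum_erase _ _ (Finset.mem_univ (0 : ZMod p))]
    rw [Finset.sum_congr rfl fun s hs =>
      ZMod.pow_card_sub_one_eq_one (Finset.ne_of_mem_erase hs)]
    rw [Finset.sum_const, Finset.card_erase_of_mem (Finset.mem_univ _), Finset.card_univ,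
      ZMod.card, nsmul_eq_mul, Nat.cast_sub (by omega), zero_pow (by omega)]
    simp
  rw [this]; simp

/-- Sums `∑ s^a (us+w)^n`. -/
lemma psum_lt (u w : MvPolynomial (Fin 4) F) (a n : ℕ) (h : a + n < p - 1) :
    ∑ s : ZMod p, (cs p F s) ^ a * (u * cs p F s + w) ^ n = 0 := by
  simp_rw [add_pow, Finset.mul_sum]
  rw [Finset.sum_comm]
  apply Finset.sum_eq_zero
  intro m hm
  rw [Finset.mem_range] at hm
  have : ∀ s : ZMod p, cs p F s ^ a * ((u * cs p F s) ^ m * w ^ (n - m) * (n.choose m : MvPolynomial (Fin 4) F))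
      = (u ^ m * w ^ (n - m) * (n.choose m : MvPolynomial (Fin 4) F)) * cs p F s ^ (a + m) := by
    intro s; rw [mul_pow, pow_add]; ring
  simp_rw [this]
  rw [← Finset.mul_sum, sum_cs_lt (by omega), mul_zero]

lemma psum_eq (hp : 3 < p) (u w : MvPolynomial (Fin 4) F) (a n : ℕ) (h : a + n = p - 1) :
    ∑ s : ZMod p, (cs p F s) ^ a * (u * cs p F s + w) ^ n = - u ^ n := by
  simp_rw [add_pow, Finset.mul_sum]
  rw [Finset.sum_comm, Finset.sum_range_succ]
  have : ∀ (s : ZMod p) m, cs p F s ^ a * ((u * cs p F s) ^ m * w ^ (n - m) * (n.choose m : MvPolynomial (Fin 4) F))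
      = (u ^ m * w ^ (n - m) * (n.choose m : MvPolynomial (Fin 4) F)) * cs p F s ^ (a + m) := by
    intro s m; rw [mul_pow, pow_add]; ring
  simp_rw [this]
  rw [← Finset.mul_sum, h, sum_cs_eq hp, Finset.sum_eq_zero]
  · simp
  · intro m hm
    rw [Finset.mem_range] at hm
    rw [← Finset.mul_sum, sum_cs_lt (by omega), mul_zero]

lemma psum_p (hp : 3 < p) (u w : MvPolynomial (Fin 4) F) (a n : ℕ) (h : a + (n + 1) = p) :
    ∑ s : ZMod p, (cs p F s) ^ a * (u * cs p F s + w) ^ (n + 1) =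
      - (((n + 1 : ℕ) : MvPolynomial (Fin 4) F) * u ^ n * w) := by
  simp_rw [add_pow, Finset.mul_sum]
  rw [Finset.sum_comm, Finset.sum_range_succ, Finset.sum_range_succ]
  have : ∀ (s : ZMod p) m, cs p F s ^ a * ((u * cs p F s) ^ m * w ^ (n + 1 - m) *
      ((n + 1).choose m : MvPolynomial (Fin 4) F))
      = (u ^ m * w ^ (n + 1 - m) * ((n + 1).choose m : MvPolynomial (Fin 4) F)) *
        cs p F s ^ (a + m) := by
    intro s m; rw [mul_pow, pow_add]; ring
  simp_rw [this]
  have h2 : ∑ s : ZMod p, cs p F s ^ (a + (n + 1)) = 0 := by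
    rw [h]
    simp_rw [← map_pow, ZMod.pow_card]
    have := sum_cs_lt (p := p) (F := F) (j := 1) (by omega)
    simpa using this
  rw [← Finset.mul_sum, ← Finset.mul_sum, h2, show a + n = p - 1 by omega, sum_cs_eq hp,
    Finset.sum_eq_zero]
  · rw [show n + 1 - n = 1 by omega, Nat.choose_succ_self_right]
    ring
  · intro m hm
    rw [Finset.mem_range] at hm
    rw [← Finset.mul_sum, sum_cs_lt (by omega), mul_zero]

variable (p) in
/-- Power sums. -/
def PS (u w : MvPolynomial (Fin 4) F) (n : ℕ) : MvPolynomial (Fin 4) F :=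
  ∑ s : ZMod p, (u * cs p F s + w) ^ n

lemma PS_lt (u w : MvPolynomial (Fin 4) F) {n : ℕ} (h : n < p - 1) : PS p u w n = 0 := by
  have := psum_lt u w 0 n (p := p) (by omega)
  simpa [PS] using this

lemma PS_eq (hp : 3 < p) (u w : MvPolynomial (Fin 4) F) : PS p u w (p - 1) = -u ^ (p - 1) := by
  have := psum_eq hp u w 0 (p - 1) (p := p) (by omega)
  simpa [PS] using this

lemma PS_add (u w : MvPolynomial (Fin 4) F) (m : ℕ) : PS p u w (p + m) =
    u ^ p * (∑ s : ZMod p, (cs p F s) ^ 1 * (u * cs p F s + w) ^ m) + w ^ p * PS p u w m := by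
  rw [PS, PS, Finset.mul_sum, Finset.mul_sum, ← Finset.sum_add_distrib]
  refine Finset.sum_congr rfl fun s _ => ?_
  rw [pow_add, add_pow_char, mul_pow, ← map_pow (cs p F), ZMod.pow_card]
  ring

lemma PS_mid (u w : MvPolynomial (Fin 4) F) {n : ℕ} (h1 : p ≤ n) (h2 : n < 2 * p - 2) :
    PS p u w n = 0 := by
  obtain ⟨m, rfl⟩ := Nat.exists_eq_add_of_le h1
  rw [PS_add, psum_lt _ _ _ _ (by omega), PS_lt _ _ (by omega)]
  simp

lemma PS_top (hp : 3 < p) (u w : MvPolynomial (Fin 4) F) :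
    PS p u w (2 * p - 2) = - u ^ (2 * p - 2) := by
  have : 2 * p - 2 = p + (p - 2) := by omega
  rw [this, PS_add, psum_eq hp _ _ _ _ (by omega), PS_lt _ _ (by omega), pow_add]
  ring

lemma PS_top' (hp : 3 < p) (u w : MvPolynomial (Fin 4) F) :
    PS p u w (2 * p - 1) = u ^ (2 * p - 2) * w - u ^ (p - 1) * w ^ p := by
  have e : 2 * p - 1 = p + (p - 1) := by omega
  rw [e, PS_add, PS_eq hp]
  have h1 : ∑ s : ZMod p, (cs p F s) ^ 1 * (u * cs p F s + w) ^ (p - 1) = u ^ (p - 2) * w := by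
    have := psum_p hp u w 1 (p - 2) (by omega)
    rw [show p - 2 + 1 = p - 1 by omega] at this
    rw [this, Nat.cast_sub (by omega), Nat.cast_one, CharP.cast_eq_zero]
    ring
  rw [h1]
  have : 2 * p - 2 = p + (p - 2) := by omega
  rw [this, pow_add]
  ring

lemma three_ne (hp : 3 < p) : (3 : F) ≠ 0 := by
  have : ((3 : ℕ) : F) ≠ 0 := by
    rw [Ne, CharP.cast_eq_zero_iff F p]
    intro h; have := Nat.le_of_dvd (by omega) h; omega
  exact_mod_cast this

lemma two_ne (hp : 3 < p) : (2 : F) ≠ 0 := by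
  have : ((2 : ℕ) : F) ≠ 0 := by
    rw [Ne, CharP.cast_eq_zero_iff F p]
    intro h; have := Nat.le_of_dvd (by omega) h; omega
  exact_mod_cast this

lemma choose_ne {i j : ℕ} (hi : i < p) (hj : j ≤ i) : (i.choose j : F) ≠ 0 := by
  rw [Ne, CharP.cast_eq_zero_iff F p]
  intro h
  have h1 : i.choose j ∣ i.factorial := by
    rw [← Nat.choose_mul_factorial_mul_factorial hj, mul_assoc]; exact dvd_mul_right _ _
  have := ((Fact.out : p.Prime).dvd_factorial).1 (h.trans h1)
  omega

lemma phi_act_X1 (s : ZMod p) : phi F (act p F !![1, s; 0, 1] (X 1)) = X 1 := by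
  simp [act_X1]

lemma phi_act_X2 (s : ZMod p) : phi F (act p F !![1, s; 0, 1] (X 2)) = X 2 + 2 * cs p F s * X 1 := by
  simp [act_X2, cs, map_ofNat]; ring

lemma phi_act_X3 (s : ZMod p) : phi F (act p F !![1, s; 0, 1] (X 3)) =
    X 3 + 3 * cs p F s * X 2 + 3 * cs p F s ^ 2 * X 1 := by
  simp [act_X3, cs, map_ofNat]; ring

lemma phi_act_xi (s : ZMod p) : phi F (act p F !![1, s; 0, 1] (xipoly F)) = xipoly F := by
  simp only [xipoly, map_sub, map_mul, map_pow, map_ofNat, phi_act_X1, phi_act_X2, phi_act_X3]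
  ring

lemma phi_xi : phi F (xipoly F) = xipoly F := by
  simp [xipoly, map_ofNat]

lemma phi_trP_mul {h : MvPolynomial (Fin 4) F}
    (hh : ∀ s : ZMod p, phi F (act p F !![1, s; 0, 1] h) = h) (c : MvPolynomial (Fin 4) F) :
    phi F (trP p F (c * h)) = phi F (trP p F c) * h := by
  simp only [trP, map_sum, map_mul, hh, Finset.sum_mul]

lemma twelve_Q (s : ZMod p) : 12 * X 1 * (X 3 + 3 * cs p F s * X 2 + 3 * cs p F s ^ 2 * X 1)
    = (6 * X 1 * cs p F s + 3 * X 2) ^ 2 + (- 3 * xipoly F) := by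
  rw [xipoly]; ring

/-- Expansion of the traces of powers of `X 3`. -/
lemma trace_expand (i : ℕ) : (12 * X 1) ^ i * phi F (trP p F (X 3 ^ i)) =
    ∑ j ∈ Finset.range (i + 1), (-3 * xipoly F) ^ (i - j) * (i.choose j : MvPolynomial (Fin 4) F) *
      PS p (6 * X 1) (3 * X 2) (2 * j) := by
  simp only [trP, map_sum, map_pow, phi_act_X3, Finset.mul_sum]
  have : ∀ s : ZMod p, (12 * X 1 : MvPolynomial (Fin 4) F) ^ i *
      (X 3 + 3 * cs p F s * X 2 + 3 * cs p F s ^ 2 * X 1) ^ i =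
      ∑ j ∈ Finset.range (i + 1), (-3 * xipoly F) ^ (i - j) * (i.choose j : MvPolynomial (Fin 4) F) *
      (6 * X 1 * cs p F s + 3 * X 2) ^ (2 * j) := by
    intro s
    rw [← mul_pow, twelve_Q, add_pow]
    refine Finset.sum_congr rfl fun j _ => ?_
    rw [pow_mul]; ring
  simp_rw [this]
  rw [Finset.sum_comm]
  simp only [PS, Finset.mul_sum]

lemma trace_expand' (i : ℕ) : (12 * X 1) ^ i * (3 * phi F (trP p F (X 2 * X 3 ^ i))) =
    ∑ j ∈ Finset.range (i + 1), (-3 * xipoly F) ^ (i - j) * (i.choose j : MvPolynomial (Fin 4) F) *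
      PS p (6 * X 1) (3 * X 2) (2 * j + 1) := by
  simp only [trP, map_sum, map_pow, map_mul, phi_act_X3, phi_act_X2, Finset.mul_sum]
  have : ∀ s : ZMod p, (12 * X 1 : MvPolynomial (Fin 4) F) ^ i * (3 * ((X 2 + 2 * cs p F s * X 1) *
      (X 3 + 3 * cs p F s * X 2 + 3 * cs p F s ^ 2 * X 1) ^ i)) =
      ∑ j ∈ Finset.range (i + 1), (-3 * xipoly F) ^ (i - j) * (i.choose j : MvPolynomial (Fin 4) F) *
      (6 * X 1 * cs p F s + 3 * X 2) ^ (2 * j + 1) := by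
    intro s
    have h1 : (12 * X 1 : MvPolynomial (Fin 4) F) ^ i * (3 * ((X 2 + 2 * cs p F s * X 1) *
      (X 3 + 3 * cs p F s * X 2 + 3 * cs p F s ^ 2 * X 1) ^ i)) = (6 * X 1 * cs p F s + 3 * X 2) *
      (12 * X 1 * (X 3 + 3 * cs p F s * X 2 + 3 * cs p F s ^ 2 * X 1)) ^ i := by
      rw [mul_pow (12 * X 1)]; ring
    rw [h1, twelve_Q, add_pow, Finset.mul_sum]
    refine Finset.sum_congr rfl fun j _ => ?_
    rw [pow_succ _ (2 * j), pow_mul]; ring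
  simp_rw [this]
  rw [Finset.sum_comm]
  simp only [PS, Finset.mul_sum]

lemma twelveX_ne (hp : 3 < p) : (12 * X 1 : MvPolynomial (Fin 4) F) ≠ 0 := by
  have h12 : (12 : F) ≠ 0 := by
    have : (12 : F) = 2 * 2 * 3 := by norm_num
    rw [this]
    exact mul_ne_zero (mul_ne_zero (two_ne hp) (two_ne hp)) (three_ne hp)
  have : (12 : MvPolynomial (Fin 4) F) = C 12 := by simp only [map_ofNat]
  rw [this]
  exact mul_ne_zero (by rwa [Ne, C_eq_zero]) (X_ne_zero _)

lemma threeP_ne (hp : 3 < p) : (3 : MvPolynomial (Fin 4) F) ≠ 0 := by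
  have : (3 : MvPolynomial (Fin 4) F) = C 3 := by simp only [map_ofNat]
  rw [this, Ne, C_eq_zero]
  exact three_ne hp

variable (p F) in
/-- Trace constants. -/
def kap (i : ℕ) : F := -(i.choose ((p - 1) / 2)) * (-3) ^ (i - (p - 1) / 2) / 12 ^ i

lemma kap_ne (hp : 3 < p) {i : ℕ} (hi : i < p) (hi2 : (p - 1) / 2 ≤ i) : kap p F i ≠ 0 := by
  have h12 : (12 : F) ≠ 0 := by
    have : (12 : F) = 2 * 2 * 3 := by norm_num
    rw [this]
    exact mul_ne_zero (mul_ne_zero (two_ne hp) (two_ne hp)) (three_ne hp)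
  exact div_ne_zero (mul_ne_zero (neg_ne_zero.2 (choose_ne hi hi2))
    (pow_ne_zero _ (neg_ne_zero.2 (three_ne hp)))) (pow_ne_zero _ h12)

lemma p_odd (hp : 3 < p) : ∃ h, p = 2 * h + 1 := (Fact.out : p.Prime).odd_of_ne_two (by omega)

lemma six_pow (hp : 3 < p) : (6 : MvPolynomial (Fin 4) F) ^ (p - 1) = 1 := by
  have h6 : (6 : ZMod p) ≠ 0 := by
    have h2 := two_ne (F := ZMod p) hp
    have h3 := three_ne (F := ZMod p) hp
    have : (6 : ZMod p) = 2 * 3 := by norm_num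
    rw [this]; exact mul_ne_zero h2 h3
  have := ZMod.pow_card_sub_one_eq_one h6
  have h := congrArg (cs p F) this
  rw [map_pow, map_ofNat, map_one] at h
  exact h

lemma T1_zero (hp : 3 < p) {i : ℕ} (hi : i < (p - 1) / 2) : phi F (trP p F (X 3 ^ i)) = 0 := by
  have h := trace_expand (p := p) (F := F) i
  rw [Finset.sum_eq_zero] at h
  · exact (mul_eq_zero.1 h).resolve_left (pow_ne_zero _ (twelveX_ne hp))
  · intro j hj
    rw [Finset.mem_range] at hj
    rw [PS_lt _ _ (by omega), mul_zero]

lemma kap_mul (hp : 3 < p) (i : ℕ) : (12 * X 1 : MvPolynomial (Fin 4) F) ^ i * C (kap p F i) =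
    X 1 ^ i * (-(i.choose ((p - 1) / 2) : MvPolynomial (Fin 4) F) * (-3) ^ (i - (p - 1) / 2)) := by
  have h12 : (12 : F) ≠ 0 := by
    have : (12 : F) = 2 * 2 * 3 := by norm_num
    rw [this]
    exact mul_ne_zero (mul_ne_zero (two_ne hp) (two_ne hp)) (three_ne hp)
  have h1 : (12 : F) ^ i * kap p F i = -(i.choose ((p - 1) / 2)) * (-3) ^ (i - (p - 1) / 2) := by
    rw [kap]; field_simp
  have h2 := congrArg (C : F → MvPolynomial (Fin 4) F) h1
  simp only [map_mul, map_pow, map_ofNat, map_neg, map_natCast] at h2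
  rw [mul_pow]
  linear_combination X 1 ^ i * h2

lemma T1 (hp : 3 < p) {i : ℕ} (hi : (p - 1) / 2 ≤ i) (hi2 : i < p - 1) :
    phi F (trP p F (X 3 ^ i)) =
      C (kap p F i) * X 1 ^ (p - 1 - i) * xipoly F ^ (i - (p - 1) / 2) := by
  obtain ⟨h, hh⟩ := p_odd hp
  have e := trace_expand (p := p) (F := F) i
  rw [Finset.sum_eq_single ((p - 1) / 2)] at e
  · rw [show 2 * ((p - 1) / 2) = p - 1 by omega, PS_eq hp, mul_pow 6, six_pow hp] at e
    apply mul_left_cancel₀ (pow_ne_zero i (twelveX_ne hp (F := F)))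
    rw [e]
    have e3 := kap_mul (F := F) hp i
    have e4 : (X 1 : MvPolynomial (Fin 4) F) ^ (p - 1) = X 1 ^ i * X 1 ^ (p - 1 - i) := by
      rw [← pow_add]; congr 1; omega
    rw [e4, mul_pow]
    linear_combination (- X 1 ^ (p - 1 - i) * xipoly F ^ (i - (p - 1) / 2)) * e3
  · intro j hj hne
    rw [Finset.mem_range] at hj
    rcases lt_or_ge (2 * j) (p - 1) with hl | hl
    · rw [PS_lt _ _ hl, mul_zero]
    · rw [PS_mid _ _ (by omega) (by omega), mul_zero]
  · intro hn
    exact absurd (Finset.mem_range.2 (by omega)) hn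

lemma T2 (hp : 3 < p) : phi F (trP p F (X 3 ^ (p - 1))) =
      C (kap p F (p - 1)) * xipoly F ^ ((p - 1) / 2) - X 1 ^ (p - 1) := by
  obtain ⟨h, hh⟩ := p_odd hp
  have e := trace_expand (p := p) (F := F) (p - 1)
  rw [Finset.sum_range_succ, Finset.sum_eq_single ((p - 1) / 2)] at e
  · have e5 : 2 * ((p - 1) / 2) = p - 1 := by omega
    have e6 : 2 * (p - 1) = 2 * p - 2 := by omega
    have e7 : 2 * p - 2 = (p - 1) + (p - 1) := by omega
    rw [e5, e6, PS_eq hp, PS_top hp, mul_pow 6, mul_pow 6 (X 1) (2 * p - 2), e7, pow_add 6,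
      six_pow hp] at e
    apply mul_left_cancel₀ (pow_ne_zero (p - 1) (twelveX_ne hp (F := F)))
    rw [e]
    have e3 := kap_mul (F := F) hp (p - 1)
    have e8 : (12 : MvPolynomial (Fin 4) F) ^ (p - 1) = 1 := by
      have h6 : (12 : ZMod p) ≠ 0 := by
        have h2 := two_ne (F := ZMod p) hp
        have h3 := three_ne (F := ZMod p) hp
        have : (12 : ZMod p) = 2 * 2 * 3 := by norm_num
        rw [this]; exact mul_ne_zero (mul_ne_zero h2 h2) h3
      have := ZMod.pow_card_sub_one_eq_one h6
      have h := congrArg (cs p F) this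
      rw [map_pow, map_ofNat, map_one] at h
      exact h
    rw [mul_pow 12, e8] at e3 ⊢
    rw [show (p - 1) - (p - 1) / 2 = (p - 1) / 2 by omega] at e3 ⊢
    rw [pow_add]
    simp only [Nat.sub_self, pow_zero, Nat.choose_self, Nat.cast_one]
    rw [mul_pow (-3)]
    linear_combination (- xipoly F ^ ((p - 1) / 2)) * e3
  · intro j hj hne
    rw [Finset.mem_range] at hj
    rcases lt_or_ge (2 * j) (p - 1) with hl | hl
    · rw [PS_lt _ _ hl, mul_zero]
    · rw [PS_mid _ _ (by omega) (by omega), mul_zero]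
  · intro hn
    exact absurd (Finset.mem_range.2 (by omega)) hn

lemma T3 (hp : 3 < p) {i : ℕ} (hi2 : i < p - 1) :
    phi F (trP p F (X 2 * X 3 ^ i)) = 0 := by
  obtain ⟨h, hh⟩ := p_odd hp
  have e := trace_expand' (p := p) (F := F) i
  rw [Finset.sum_eq_zero] at e
  · exact (mul_eq_zero.1 ((mul_eq_zero.1 e).resolve_left
      (pow_ne_zero _ (twelveX_ne hp)))).resolve_left (threeP_ne hp)
  · intro j hj
    rw [Finset.mem_range] at hj
    rcases lt_or_ge (2 * j + 1) (p - 1) with hl | hl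
    · rw [PS_lt _ _ hl, mul_zero]
    · rw [PS_mid _ _ (by omega) (by omega), mul_zero]

lemma T4 (hp : 3 < p) : 3 * phi F (X 1 * trP p F (X 2 * X 3 ^ (p - 1))) = - phi F (Lpoly p F) := by
  obtain ⟨h, hh⟩ := p_odd hp
  have e := trace_expand' (p := p) (F := F) (p - 1)
  rw [Finset.sum_range_succ, Finset.sum_eq_zero] at e
  · have e6 : 2 * (p - 1) + 1 = 2 * p - 1 := by omega
    have e7 : 2 * p - 2 = (p - 1) + (p - 1) := by omega
    have e8 : (12 : MvPolynomial (Fin 4) F) ^ (p - 1) = 1 := by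
      have h6 : (12 : ZMod p) ≠ 0 := by
        have h2 := two_ne (F := ZMod p) hp
        have h3 := three_ne (F := ZMod p) hp
        have : (12 : ZMod p) = 2 * 2 * 3 := by norm_num
        rw [this]; exact mul_ne_zero (mul_ne_zero h2 h2) h3
      have := ZMod.pow_card_sub_one_eq_one h6
      have h := congrArg (cs p F) this
      rw [map_pow, map_ofNat, map_one] at h
      exact h
    have h3 : (3 : MvPolynomial (Fin 4) F) ^ p = 3 := by
      have := congrArg (cs p F) (ZMod.pow_card (3 : ZMod p))
      rw [map_pow, map_ofNat] at this
      exact this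
    rw [e6, PS_top' hp, mul_pow 6, mul_pow 6 (X 1) (p - 1), e7, pow_add 6,
      six_pow hp, mul_pow 12, e8, mul_pow 3, h3, pow_add] at e
    simp only [Nat.sub_self, pow_zero, Nat.choose_self, Nat.cast_one] at e
    apply mul_left_cancel₀ (pow_ne_zero (p - 1) (X_ne_zero (R := F) (1 : Fin 4)))
    have e9 : (X 1 : MvPolynomial (Fin 4) F) ^ p = X 1 ^ (p - 1) * X 1 := by
      rw [← pow_succ]; congr 1; omega
    have e10 : (0 : MvPolynomial (Fin 4) F) ^ p = 0 := zero_pow (by omega)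
    simp only [Lpoly, map_mul, map_sub, map_pow, map_ofNat, phi_X0, phi_X1, phi_X2, phi_X3, e10]
    rw [e9]
    linear_combination X 1 * e
  · intro j hj
    rw [Finset.mem_range] at hj
    rcases lt_or_ge (2 * j + 1) (p - 1) with hl | hl
    · rw [PS_lt _ _ hl, mul_zero]
    · rw [PS_mid _ _ (by omega) (by omega), mul_zero]

lemma phi_Kp (hp : 3 < p) : phi F (Kp p F) = 
    X 1 ^ (p - 1) - C (kap p F (p - 1)) * xipoly F ^ ((p - 1) / 2) := by
  rw [Kp_eq, map_sub, T2 hp, map_neg, map_pow, phi_X0, zero_pow (by omega)]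
  ring

lemma phi_D : phi F (Dpoly F) = X 1 ^ 2 * xipoly F := by
  simp [Dpoly, xipoly, map_ofNat]; ring

lemma phi_e : phi F (epoly F) = 2 * X 1 ^ 3 := by
  simp [epoly, map_ofNat]

lemma phi_d : phi F (dpoly F) = X 1 ^ 2 := by
  simp [dpoly]

lemma phi_N : phi F (Npoly p F) = ∏ s : ZMod p, 
    (X 3 + 3 * cs p F s * X 2 + 3 * cs p F s ^ 2 * X 1) := by
  rw [Npoly, map_prod]
  exact Finset.prod_congr rfl fun s _ => phi_act_X3 s

end Traces

section Acyclic

variable {p : ℕ} [Fact p.Prime] {F : Type} [Field F] [CharP F p]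

variable (F) in
/-- Setting the first `i` variables to zero. -/
def psi (i : ℕ) : MvPolynomial (Fin 4) F →ₐ[F] MvPolynomial (Fin 4) F :=
  aeval (fun j : Fin 4 => if j.val < i then 0 else X j)

lemma psi_X (i : ℕ) (j : Fin 4) : psi F i (X j) = if j.val < i then 0 else X j := by
  simp [psi]

lemma psi_hom {i : ℕ} {f : MvPolynomial (Fin 4) F} {n : ℕ} (hf : f.IsHomogeneous n) :
    (psi F i f).IsHomogeneous n := by
  have h := hf.aeval (fun j : Fin 4 => if j.val < i then (0 : MvPolynomial (Fin 4) F) else X j)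
    (n := 1) (by
      intro j
      split_ifs
      · exact isHomogeneous_zero _ _ _
      · exact isHomogeneous_X _ _)
  rwa [one_mul] at h

lemma hc_psi (i n : ℕ) (f : MvPolynomial (Fin 4) F) :
    homogeneousComponent n (psi F i f) = psi F i (homogeneousComponent n f) := by
  conv_lhs => rw [← sum_homogeneousComponent f]
  rw [map_sum, map_sum]
  have : ∀ j, homogeneousComponent n (psi F i (homogeneousComponent j f))
      = if j = n then psi F i (homogeneousComponent n f) else 0 := by
    intro j
    rw [homogeneousComponent_of_mem
      (psi_hom (homogeneousComponent_isHomogeneous j f))]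
    split_ifs with h1 h2 h2
    · rw [h1]
    · exact absurd h1.symm h2
    · exact absurd h2.symm h1
    · rfl
  simp only [this]
  rw [Finset.sum_ite_eq']
  split_ifs with h
  · rfl
  · rw [homogeneousComponent_eq_zero, map_zero]
    simpa using h

lemma psi_idem (i j : ℕ) (hij : j ≤ i) (f : MvPolynomial (Fin 4) F) :
    psi F i (psi F j f) = psi F i f := by
  have : (psi F i).comp (psi F j) = psi F i := by
    apply MvPolynomial.algHom_ext
    intro l
    rw [AlgHom.comp_apply, psi_X, psi_X]
    split_ifs with h1 h2 h2
    · simp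
    · omega
    · rw [psi_X, if_pos h2]
    · rw [psi_X, if_neg h2]
  exact DFunLike.congr_fun this f

lemma psi_act (i : ℕ) (s : ZMod p) (f : MvPolynomial (Fin 4) F) :
    psi F i (act p F !![1, s; 0, 1] (psi F i f)) = psi F i (act p F !![1, s; 0, 1] f) := by
  have : ((psi F i).comp (act p F !![1, s; 0, 1])).comp (psi F i) =
      (psi F i).comp (act p F !![1, s; 0, 1]) := by
    apply MvPolynomial.algHom_ext
    intro l
    simp only [AlgHom.comp_apply]
    rw [psi_X]
    split_ifs with h1
    · rw [map_zero, map_zero]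
      symm
      fin_cases l
      · change psi F i (act p F !![1, s; 0, 1] (X 0)) = 0
        rw [act_X0]
        simp at h1
        simp [psi_X, h1]
      · change psi F i (act p F !![1, s; 0, 1] (X 1)) = 0
        rw [act_X1]
        simp at h1
        simp [psi_X, h1]
        intro h; omega
      · change psi F i (act p F !![1, s; 0, 1] (X 2)) = 0
        rw [act_X2]
        simp at h1
        have e0 : 0 < i := by omega
        have e1 : 1 < i := by omega
        simp [psi_X, h1, e0, e1]
      · change psi F i (act p F !![1, s; 0, 1] (X 3)) = 0
        rw [act_X3]
        simp at h1
        have e0 : 0 < i := by omega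
        have e1 : 1 < i := by omega
        have e2 : 2 < i := by omega
        simp [psi_X, h1, e0, e1, e2]
    · rfl
  exact DFunLike.congr_fun this f

lemma psi_step (i : ℕ) (hi : i < 4) (f : MvPolynomial (Fin 4) F) :
    X ⟨i, hi⟩ ∣ psi F i f - psi F (i + 1) f := by
  induction f using MvPolynomial.induction_on with
  | C a => simp [psi]
  | add f g hf hg =>
    have : psi F i (f + g) - psi F (i + 1) (f + g) =
      (psi F i f - psi F (i + 1) f) + (psi F i g - psi F (i + 1) g) := by simp only [map_add]; ring
    rw [this]; exact dvd_add hf hg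
  | mul_X f j hf =>
    have : psi F i (f * X j) - psi F (i + 1) (f * X j) =
      (psi F i f - psi F (i + 1) f) * psi F i (X j) +
      psi F (i + 1) f * (psi F i (X j) - psi F (i + 1) (X j)) := by
      simp only [map_mul]; ring
    rw [this]
    refine dvd_add (hf.mul_right _) (Dvd.dvd.mul_left ?_ _)
    rw [psi_X, psi_X]
    split_ifs with h1 h2 h2
    · simp
    · omega
    · have : j = ⟨i, hi⟩ := by apply Fin.ext; simp only; omega
      rw [this]; simp
    · simp

variable (p F) in
/-- The ideals used in the descent. -/
def JJ (i : ℕ) : Ideal (MvPolynomial (Fin 4) F) :=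
  Ideal.comap (psi F i).toRingHom (Ideal.span {psi F i (Npoly p F)})

lemma mem_JJ {i : ℕ} {f : MvPolynomial (Fin 4) F} :
    f ∈ JJ p F i ↔ psi F i (Npoly p F) ∣ psi F i f := by
  rw [JJ, Ideal.mem_comap, Ideal.mem_span_singleton]; rfl

lemma JJ_act {i : ℕ} {f : MvPolynomial (Fin 4) F} (hf : f ∈ JJ p F i) (s : ZMod p) :
    act p F !![1, s; 0, 1] f ∈ JJ p F i := by
  rw [mem_JJ] at *
  obtain ⟨q, hq⟩ := hf
  have h1 : psi F i f = psi F i (Npoly p F * q) := by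
    have := congrArg (psi F i) hq
    rw [psi_idem i i le_rfl, map_mul, psi_idem i i le_rfl] at this
    rw [this, map_mul]
  rw [← psi_act, h1, psi_act, map_mul, N_PInv, map_mul]
  exact dvd_mul_right _ _

lemma JJ_trP {i : ℕ} {f : MvPolynomial (Fin 4) F} (hf : f ∈ JJ p F i) :
    trP p F f ∈ JJ p F i := Ideal.sum_mem _ fun s _ => JJ_act hf s

lemma JJ_hc {i : ℕ} {f : MvPolynomial (Fin 4) F} (hf : f ∈ JJ p F i) (n : ℕ) :
    homogeneousComponent n f ∈ JJ p F i := by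
  rw [mem_JJ] at *
  rw [← hc_psi]
  obtain ⟨q, hq⟩ := hf
  rw [hq]
  rcases le_or_gt p n with h | h
  · rw [hc_mul_left F (psi_hom N_homog) n h]; exact dvd_mul_right _ _
  · rw [hc_mul_left_zero F (psi_hom N_homog) n h]; exact dvd_zero _

lemma JJ_succ {i : ℕ} (hi : i < 4) {f : MvPolynomial (Fin 4) F} (hf : f ∈ JJ p F (i + 1)) :
    ∃ w, f - X ⟨i, hi⟩ * w ∈ JJ p F i := by
  rw [mem_JJ] at hf
  obtain ⟨q, hq⟩ := hf
  have h1 : psi F (i + 1) (f - Npoly p F * q) = 0 := by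
    have := congrArg (psi F (i + 1)) hq
    rw [psi_idem _ _ le_rfl, map_mul, psi_idem _ _ le_rfl] at this
    rw [map_sub, this, map_mul, sub_self]
  obtain ⟨w, hw⟩ := psi_step i hi (f - Npoly p F * q)
  rw [h1, sub_zero] at hw
  have hw2 := congrArg (psi F i) hw
  rw [psi_idem _ _ le_rfl, map_sub, map_mul] at hw2
  refine ⟨w, ?_⟩
  rw [mem_JJ]
  refine ⟨psi F i q, ?_⟩
  rw [map_sub]
  linear_combination hw2

lemma JJ_le {i : ℕ} {f : MvPolynomial (Fin 4) F} (hf : f ∈ JJ p F i) : f ∈ JJ p F (i + 1) := by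
  rw [mem_JJ] at *
  have := map_dvd (psi F (i + 1)) hf
  rwa [psi_idem _ _ (by omega), psi_idem _ _ (by omega)] at this

lemma JJ_X {i : ℕ} (hi : i < 4) : (X ⟨i, hi⟩ : MvPolynomial (Fin 4) F) ∈ JJ p F (i + 1) := by
  rw [mem_JJ, psi_X, if_pos (by simp)]; exact dvd_zero _

lemma N_eval {i : ℕ} (hi : i < 4) (hi3 : i < 3) : ¬ (X ⟨i, hi⟩ ∣ psi F i (Npoly p F)) := by
  intro h
  have h1 := map_dvd (eval (![0, 0, 0, 1] : Fin 4 → F)) h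
  have h2 : eval (![0, 0, 0, 1] : Fin 4 → F) (X ⟨i, hi⟩) = 0 := by
    interval_cases i <;> simp
  have h3 : eval (![0, 0, 0, 1] : Fin 4 → F) (psi F i (Npoly p F)) = 1 := by
    have : (aeval (![0, 0, 0, 1] : Fin 4 → F)).comp (psi F i) = aeval (![0, 0, 0, 1] : Fin 4 → F) := by
      apply MvPolynomial.algHom_ext
      intro j
      rw [AlgHom.comp_apply, psi_X]
      split_ifs with hj
      · fin_cases j <;> simp at hj ⊢
        omega
      · rfl
    have h4 : aeval (![0, 0, 0, 1] : Fin 4 → F) (psi F i (Npoly p F)) = aeval (![0, 0, 0, 1] : Fin 4 → F) (Npoly p F) :=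
      DFunLike.congr_fun this _
    rw [aeval_eq_eval] at h4
    rw [h4, Npoly_eq, map_prod]
    apply Finset.prod_eq_one
    intro s _
    simp [lin]
  rw [h2, h3] at h1
  simp at h1

lemma JJ_nzd {i : ℕ} (hi : i < 4) (hi3 : i < 3) {f : MvPolynomial (Fin 4) F}
    (hf : X ⟨i, hi⟩ * f ∈ JJ p F i) : f ∈ JJ p F i := by
  rw [mem_JJ] at *
  rw [map_mul, psi_X, if_neg (by simp)] at hf
  obtain ⟨q, hq⟩ := hf
  have hX : Prime (X ⟨i, hi⟩ : MvPolynomial (Fin 4) F) := X_prime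
  have h1 : X ⟨i, hi⟩ ∣ psi F i (Npoly p F) * q := ⟨_, hq.symm⟩
  obtain ⟨r, hr⟩ := (hX.dvd_or_dvd h1).resolve_left (N_eval hi hi3)
  refine ⟨r, mul_left_cancel₀ hX.ne_zero ?_⟩
  rw [hq, hr]; ring

variable (p F) in
/-- Vanishing of degree zero Tate cohomology in degree `r`. -/
def H0 (i r : ℕ) : Prop := ∀ h : MvPolynomial (Fin 4) F, h.IsHomogeneous r →
  (∀ s : ZMod p, act p F !![1, s; 0, 1] h - h ∈ JJ p F i) → ∃ c, h - trP p F c ∈ JJ p F i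

variable (p F) in
/-- Vanishing of degree minus one Tate cohomology in degree `r`. -/
def Hm (i r : ℕ) : Prop := ∀ c : MvPolynomial (Fin 4) F, c.IsHomogeneous r →
  trP p F c ∈ JJ p F i → ∃ u, c - (act p F !![1, 1; 0, 1] u - u) ∈ JJ p F i

lemma act_u_add (s t : ZMod p) (f : MvPolynomial (Fin 4) F) :
    act p F !![1, s; 0, 1] (act p F !![1, t; 0, 1] f) = act p F !![1, s + t; 0, 1] f := by
  have e : (!![1, t; 0, 1] * !![1, s; 0, 1] : Matrix (Fin 2) (Fin 2) (ZMod p)) = !![1, s + t; 0, 1] := by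
    simp
  rw [act_mul, e]

lemma act_u_zero (f : MvPolynomial (Fin 4) F) : act p F !![1, 0; 0, 1] f = f := by
  rw [← Matrix.one_fin_two, act_one]

lemma trP_act_u (s : ZMod p) (f : MvPolynomial (Fin 4) F) :
    trP p F (act p F !![1, s; 0, 1] f) = trP p F f := by
  rw [trP, trP]
  simp_rw [act_u_add]
  exact Equiv.sum_comp (Equiv.addRight s) (fun t => act p F !![1, t; 0, 1] f)

lemma act_u_nat (f : MvPolynomial (Fin 4) F) (n : ℕ) :
    ∃ u, act p F !![1, (n : ZMod p); 0, 1] f - f = act p F !![1, 1; 0, 1] u - u := by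
  induction n with
  | zero => exact ⟨0, by rw [Nat.cast_zero, act_u_zero]; simp⟩
  | succ n ih =>
    obtain ⟨u, hu⟩ := ih
    refine ⟨u + act p F !![1, (n : ZMod p); 0, 1] f, ?_⟩
    rw [map_add, act_u_add, Nat.cast_succ, add_comm (1 : ZMod p)]
    linear_combination hu

lemma act_u_img (f : MvPolynomial (Fin 4) F) (s : ZMod p) :
    ∃ u, act p F !![1, s; 0, 1] f - f = act p F !![1, 1; 0, 1] u - u := by
  have := act_u_nat f s.val (p := p)
  rwa [ZMod.natCast_zmod_val] at this

lemma JJ_all_s {i : ℕ} {f : MvPolynomial (Fin 4) F}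
    (hf : act p F !![1, 1; 0, 1] f - f ∈ JJ p F i) (s : ZMod p) :
    act p F !![1, s; 0, 1] f - f ∈ JJ p F i := by
  have key : ∀ n : ℕ, act p F !![1, (n : ZMod p); 0, 1] f - f ∈ JJ p F i := by
    intro n
    induction n with
    | zero => rw [Nat.cast_zero, act_u_zero]; simp
    | succ n ih =>
      have : act p F !![1, ((n + 1 : ℕ) : ZMod p); 0, 1] f - f =
        act p F !![1, 1; 0, 1] (act p F !![1, (n : ZMod p); 0, 1] f - f) +
        (act p F !![1, 1; 0, 1] f - f) := by
        rw [map_sub, act_u_add, Nat.cast_succ, add_comm (1 : ZMod p)]; ring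
      rw [this]
      exact Ideal.add_mem _ (JJ_act ih 1) hf
  have := key s.val
  rwa [ZMod.natCast_zmod_val] at this

lemma JJ_X_inv {i : ℕ} (hi : i < 4) (s : ZMod p) :
    act p F !![1, s; 0, 1] (X ⟨i, hi⟩) - X ⟨i, hi⟩ ∈ JJ p F i := by
  rw [mem_JJ]
  have : psi F i (act p F !![1, s; 0, 1] (X ⟨i, hi⟩) - X ⟨i, hi⟩) = 0 := by
    interval_cases i
    · change psi F 0 (act p F !![1, s; 0, 1] (X 0) - X 0) = 0
      simp [act_X0]
    · change psi F 1 (act p F !![1, s; 0, 1] (X 1) - X 1) = 0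
      simp [act_X1, psi_X]
    · change psi F 2 (act p F !![1, s; 0, 1] (X 2) - X 2) = 0
      simp [act_X2, psi_X]
    · change psi F 3 (act p F !![1, s; 0, 1] (X 3) - X 3) = 0
      simp [act_X3, psi_X]
  rw [this]; exact dvd_zero _

lemma JJ_X_mul_inv {i : ℕ} (hi : i < 4) (s : ZMod p) (f : MvPolynomial (Fin 4) F) :
    act p F !![1, s; 0, 1] (X ⟨i, hi⟩ * f) - X ⟨i, hi⟩ * act p F !![1, s; 0, 1] f ∈ JJ p F i := by
  rw [map_mul, ← sub_mul]
  exact Ideal.mul_mem_right _ _ (JJ_X_inv hi s)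

lemma JJ_X_mul_trP {i : ℕ} (hi : i < 4) (f : MvPolynomial (Fin 4) F) :
    trP p F (X ⟨i, hi⟩ * f) - X ⟨i, hi⟩ * trP p F f ∈ JJ p F i := by
  rw [trP, trP, Finset.mul_sum, ← Finset.sum_sub_distrib]
  exact Ideal.sum_mem _ fun s _ => JJ_X_mul_inv hi s f

lemma H0_step {i r : ℕ} (hi : i < 4) (hi3 : i < 3) (hm : Hm p F (i + 1) (r + 1))
    {h : MvPolynomial (Fin 4) F} (hr : h.IsHomogeneous r)
    (hc : ∃ c, X ⟨i, hi⟩ * h - trP p F c ∈ JJ p F i) : ∃ c, h - trP p F c ∈ JJ p F i := by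
  obtain ⟨c0, hc0⟩ := hc
  have h1 := JJ_hc hc0 (r + 1)
  have hXr : (X ⟨i, hi⟩ * h : MvPolynomial (Fin 4) F).IsHomogeneous (r + 1) := by
    rw [add_comm]; exact (isHomogeneous_X F _).mul hr
  rw [map_sub, ← trP_hc, homogeneousComponent_of_mem hXr, if_pos rfl] at h1
  set c := homogeneousComponent (r + 1) c0
  obtain ⟨c', hc'⟩ := hm c (homogeneousComponent_isHomogeneous _ _) (by
    have h2 := Ideal.sub_mem _ (Ideal.mul_mem_right h _ (JJ_X hi)) (JJ_le h1)
    rwa [sub_sub_cancel] at h2)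
  obtain ⟨w, hw⟩ := JJ_succ hi hc'
  refine ⟨w, JJ_nzd hi hi3 ?_⟩
  have h3 := JJ_trP hw
  rw [trP_sub, trP_sub, trP_sub, trP_act_u, sub_self, sub_zero] at h3
  have h4 := JJ_X_mul_trP hi w (p := p)
  have := Ideal.add_mem _ (Ideal.add_mem _ h1 h3) h4
  convert this using 1
  ring

lemma Hm_step {i r : ℕ} (hi : i < 4) (hi3 : i < 3) (hm : H0 p F (i + 1) (r + 1))
    {c : MvPolynomial (Fin 4) F} (hr : c.IsHomogeneous r)
    (hc : ∃ u, X ⟨i, hi⟩ * c - (act p F !![1, 1; 0, 1] u - u) ∈ JJ p F i) :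
    ∃ u, c - (act p F !![1, 1; 0, 1] u - u) ∈ JJ p F i := by
  obtain ⟨u0, hu0⟩ := hc
  have h1 := JJ_hc hu0 (r + 1)
  have hXr : (X ⟨i, hi⟩ * c : MvPolynomial (Fin 4) F).IsHomogeneous (r + 1) := by
    rw [add_comm]; exact (isHomogeneous_X F _).mul hr
  rw [map_sub, map_sub, hc_act, homogeneousComponent_of_mem hXr, if_pos rfl] at h1
  set u := homogeneousComponent (r + 1) u0
  obtain ⟨v, hv⟩ := hm u (homogeneousComponent_isHomogeneous _ _) (JJ_all_s (by
    have h2 := Ideal.sub_mem _ (Ideal.mul_mem_right c _ (JJ_X hi)) (JJ_le h1)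
    rwa [sub_sub_cancel] at h2))
  obtain ⟨w, hw⟩ := JJ_succ hi hv
  refine ⟨w, JJ_nzd hi hi3 ?_⟩
  have h3 := JJ_act hw 1
  rw [map_sub, map_sub, trP_inv] at h3
  have h4 := JJ_X_mul_inv hi 1 w (p := p)
  have := Ideal.add_mem _ (Ideal.sub_mem _ (Ideal.add_mem _ h1 h3) hw) h4
  convert this using 1
  ring

/-- The start of the descent. -/
lemma start_elem (hp : 3 < p) {i : ℕ} (hi : i < 4) (hi3 : i < 3) :
    ∃ x, X ⟨i, hi⟩ ^ (p - 1) + trP p F x ∈ JJ p F i := by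
  have hpw : ∀ c : ZMod p, c ≠ 0 → cs p F c ^ (p - 1) = 1 := by
    intro c hc
    rw [← map_pow, ZMod.pow_card_sub_one_eq_one hc, map_one]
  have key : ∀ (c : ZMod p) (u w : MvPolynomial (Fin 4) F), c ≠ 0 →
      ∑ s : ZMod p, (cs p F c * u * cs p F s + w) ^ (p - 1) = - u ^ (p - 1) := by
    intro c u w hc
    have := PS_eq hp (cs p F c * u) w (p := p)
    rw [PS] at this
    rw [this, mul_pow, hpw c hc, one_mul]
  interval_cases i
  · refine ⟨X 1 ^ (p - 1), ?_⟩
    change X 0 ^ (p - 1) + _ ∈ _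
    have : trP p F (X 1 ^ (p - 1)) = - X 0 ^ (p - 1) := by
      rw [← key 1 (X 0) (X 1) one_ne_zero, trP]
      refine Finset.sum_congr rfl fun s _ => ?_
      rw [map_pow, act_X1]
      simp [cs]
      ring
    rw [this, add_neg_cancel]; exact Ideal.zero_mem _
  · refine ⟨X 2 ^ (p - 1), ?_⟩
    change X 1 ^ (p - 1) + _ ∈ _
    rw [mem_JJ]
    have : psi F 1 (X 1 ^ (p - 1) + trP p F (X 2 ^ (p - 1))) = 0 := by
      have h2 : psi F 1 (trP p F (X 2 ^ (p - 1))) = - X 1 ^ (p - 1) := by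
        rw [← key 2 (X 1) (X 2) (two_ne hp), trP, map_sum]
        refine Finset.sum_congr rfl fun s _ => ?_
        rw [map_pow, act_X2]
        simp [cs, psi_X, map_ofNat]
        ring
      rw [map_add, h2, map_pow, psi_X]
      simp
    rw [this]; exact dvd_zero _
  · refine ⟨X 3 ^ (p - 1), ?_⟩
    change X 2 ^ (p - 1) + _ ∈ _
    rw [mem_JJ]
    have : psi F 2 (X 2 ^ (p - 1) + trP p F (X 3 ^ (p - 1))) = 0 := by
      have h2 : psi F 2 (trP p F (X 3 ^ (p - 1))) = - X 2 ^ (p - 1) := by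
        rw [← key 3 (X 2) (X 3) (three_ne hp), trP, map_sum]
        refine Finset.sum_congr rfl fun s _ => ?_
        rw [map_pow, act_X3]
        simp [cs, psi_X, map_ofNat]
        ring
      rw [map_add, h2, map_pow, psi_X]
      simp
    rw [this]; exact dvd_zero _

lemma descend (hp : 3 < p) {i t : ℕ} (hi : i < 4) (hi3 : i < 3)
    (h0 : ∀ r, t + 1 ≤ r → H0 p F (i + 1) r) (hm : ∀ r, t + 1 ≤ r → Hm p F (i + 1) r) :
    ∀ r, t ≤ r → H0 p F i r ∧ Hm p F i r := by
  intro r hr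
  obtain ⟨x, hx⟩ := start_elem (F := F) hp hi hi3
  have hXm : ∀ (f : MvPolynomial (Fin 4) F), f.IsHomogeneous r → ∀ m,
      (X (⟨i, hi⟩ : Fin 4) ^ m * f : MvPolynomial (Fin 4) F).IsHomogeneous (r + m) := by
    intro f hf m
    rw [add_comm]
    have := ((isHomogeneous_X F (⟨i, hi⟩ : Fin 4)).pow m).mul hf
    rwa [one_mul] at this
  constructor
  · intro h hh hinv
    have claim : ∀ j, j ≤ p - 1 → ∃ c, X ⟨i, hi⟩ ^ (p - 1 - j) * h - trP p F c ∈ JJ p F i := by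
      intro j
      induction j with
      | zero =>
        intro _
        refine ⟨- x * h, ?_⟩
        have h1 : trP p F x * h - trP p F (x * h) ∈ JJ p F i := by
          rw [trP, trP, Finset.sum_mul, ← Finset.sum_sub_distrib]
          refine Ideal.sum_mem _ fun s _ => ?_
          rw [map_mul, ← mul_sub]
          apply Ideal.mul_mem_left
          rw [← neg_sub]
          exact (Ideal.neg_mem_iff _).2 (hinv s)
        have := Ideal.sub_mem _ (Ideal.mul_mem_right h _ hx) h1
        convert this using 1
        rw [neg_mul, trP_neg, Nat.sub_zero]; ring
      | succ j ih =>
        intro hj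
        obtain ⟨c, hc⟩ := ih (by omega)
        apply H0_step hi hi3 (hm _ (by omega)) (hXm h hh (p - 1 - (j + 1)))
        refine ⟨c, ?_⟩
        rw [← mul_assoc, ← pow_succ', show p - 1 - (j + 1) + 1 = p - 1 - j by omega]
        exact hc
    have := claim (p - 1) le_rfl
    simpa using this
  · intro c hc htr
    have claim : ∀ j, j ≤ p - 1 → ∃ u, X ⟨i, hi⟩ ^ (p - 1 - j) * c -
        (act p F !![1, 1; 0, 1] u - u) ∈ JJ p F i := by
      intro j
      induction j with
      | zero =>
        intro _
        have h1 : ∃ u, trP p F x * c - x * trP p F c = act p F !![1, 1; 0, 1] u - u := by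
          have e1 : x * trP p F c = ∑ s : ZMod p, x * act p F !![1, -s; 0, 1] c := by
            rw [trP, Finset.mul_sum]
            exact (Equiv.sum_comp (Equiv.neg (ZMod p))
              (fun s => x * act p F !![1, s; 0, 1] c)).symm
          have e2 : ∀ s : ZMod p, ∃ u, act p F !![1, s; 0, 1] x * c - x * act p F !![1, -s; 0, 1] c
              = act p F !![1, 1; 0, 1] u - u := by
            intro s
            obtain ⟨u, hu⟩ := act_u_img (x * act p F !![1, -s; 0, 1] c) s
            refine ⟨u, ?_⟩
            rw [← hu, map_mul, act_u_add, add_neg_cancel, act_u_zero]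
          choose u hu using e2
          refine ⟨∑ s, u s, ?_⟩
          rw [e1, trP, Finset.sum_mul, ← Finset.sum_sub_distrib, map_sum, ← Finset.sum_sub_distrib]
          exact Finset.sum_congr rfl fun s _ => hu s
        obtain ⟨u, hu⟩ := h1
        refine ⟨-u, ?_⟩
        have := Ideal.sub_mem _ (Ideal.mul_mem_right c _ hx) (Ideal.mul_mem_left _ x htr)
        convert this using 1
        rw [map_neg, Nat.sub_zero]
        linear_combination -hu
      | succ j ih =>
        intro hj
        obtain ⟨u, hu⟩ := ih (by omega)
        apply Hm_step hi hi3 (h0 _ (by omega)) (hXm c hc (p - 1 - (j + 1)))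
        refine ⟨u, ?_⟩
        rw [← mul_assoc, ← pow_succ', show p - 1 - (j + 1) + 1 = p - 1 - j by omega]
        exact hu
    have := claim (p - 1) le_rfl
    simpa using this

lemma JJ3_top {r : ℕ} (hr : p ≤ r) {f : MvPolynomial (Fin 4) F} (hf : f.IsHomogeneous r) :
    f ∈ JJ p F 3 := by
  rw [mem_JJ]
  have hN : psi F 3 (Npoly p F) = X 3 ^ p := by
    rw [Npoly_eq, map_prod, Finset.prod_congr rfl (g := fun _ => X 3), Finset.prod_const,
      Finset.card_univ, ZMod.card]
    intro s _
    simp [lin, psi_X]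
  rw [hN, f.as_sum, map_sum]
  refine Finset.dvd_sum fun d hd => ?_
  have hdeg : d 0 + d 1 + d 2 + d 3 = r := by
    have h1 := hf (mem_support_iff.1 hd)
    rw [Finsupp.weight_apply, Finsupp.sum_fintype _ _ (by simp)] at h1
    simpa [Fin.sum_univ_four] using h1
  rw [monomial_eq, map_mul, Finsupp.prod_fintype _ _ (by simp), map_prod]
  apply Dvd.dvd.mul_left
  simp only [map_pow, psi_X, Fin.prod_univ_four]
  simp
  by_cases h0 : d 0 = 0
  · by_cases h1 : d 1 = 0
    · by_cases h2 : d 2 = 0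
      · rw [h0, h1, h2]
        simp
        exact pow_dvd_pow _ (by omega)
      · simp [zero_pow h2]
    · simp [zero_pow h1]
  · simp [zero_pow h0]

lemma acyclic (hp : 3 < p) {r : ℕ} (hr : p - 3 ≤ r) : H0 p F 0 r := by
  have a3 : ∀ r, p - 3 + 3 ≤ r → H0 p F 3 r ∧ Hm p F 3 r := by
    intro r hr
    exact ⟨fun h hh _ => ⟨0, by rw [trP_zero, sub_zero]; exact JJ3_top (by omega) hh⟩,
      fun c hc _ => ⟨0, by rw [map_zero, sub_zero, sub_zero]; exact JJ3_top (by omega) hc⟩⟩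
  have a2 := descend hp (i := 2) (t := p - 3 + 2) (by omega) (by omega)
    (fun r hr => (a3 r hr).1) (fun r hr => (a3 r hr).2)
  have a1 := descend hp (i := 1) (t := p - 3 + 1) (by omega) (by omega)
    (fun r hr => (a2 r hr).1) (fun r hr => (a2 r hr).2)
  exact (descend hp (i := 0) (t := p - 3) (by omega) (by omega)
    (fun r hr => (a1 r hr).1) (fun r hr => (a1 r hr).2) r hr).1

lemma N_ne : Npoly p F ≠ 0 := by
  intro h
  have := N_eval (p := p) (F := F) (i := 0) (by omega) (by omega)
  rw [h] at this
  simp at this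

lemma step0_one (hp : 3 < p) {r : ℕ} (hr : p ≤ r) {h : MvPolynomial (Fin 4) F}
    (hh : h.IsHomogeneous r) (hinv : PInv p F h) :
    ∃ c b, h = trP p F c + Npoly p F * b ∧ b.IsHomogeneous (r - p) ∧ PInv p F b := by
  obtain ⟨c, hc⟩ := acyclic (F := F) hp (r := r) (by omega) h hh (fun s => by
    rw [hinv s, sub_self]; exact Ideal.zero_mem _)
  rw [mem_JJ] at hc
  have e : ∀ f : MvPolynomial (Fin 4) F, psi F 0 f = f := by
    intro f; simp [psi]
  rw [e, e] at hc
  obtain ⟨b, hb⟩ := hc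
  have h1 := congrArg (homogeneousComponent r) hb
  rw [map_sub, ← trP_hc, homogeneousComponent_of_mem hh, if_pos rfl,
    hc_mul_left F N_homog r hr] at h1
  refine ⟨homogeneousComponent r c, homogeneousComponent (r - p) b, ?_,
    homogeneousComponent_isHomogeneous _ _, ?_⟩
  · linear_combination h1
  · apply PInv.of_mul N_PInv N_ne
    rw [← h1]
    exact hinv.sub (trP_inv _)

lemma step0 (hp : 3 < p) (k : ℕ) {r : ℕ} (hr : p * k ≤ r) {h : MvPolynomial (Fin 4) F}
    (hh : h.IsHomogeneous r) (hinv : PInv p F h) :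
    ∃ c b, h = trP p F c + Npoly p F ^ k * b ∧ b.IsHomogeneous (r - p * k) ∧ PInv p F b := by
  induction k with
  | zero => exact ⟨0, h, by rw [trP_zero]; simp, by simpa using hh, hinv⟩
  | succ k ih =>
    have e : p * (k + 1) = p * k + p := by ring
    obtain ⟨c, b, h1, h2, h3⟩ := ih (by omega)
    obtain ⟨c', b', h4, h5, h6⟩ := step0_one hp (by omega) h2 h3
    refine ⟨c + Npoly p F ^ k * c', b', ?_, ?_, h6⟩
    · rw [trP_add, trP_mul (N_PInv.pow k), h1, h4]; ring
    · rw [e, Nat.sub_add_eq]; exact h5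

end Acyclic

section GoodSec

variable {p : ℕ} [Fact p.Prime] {F : Type} [Field F] [CharP F p]

variable (p) in
/-- The induction hypothesis: invariants of degree less than `n` lie in `A`. -/
def IHyp (n : ℕ) (A : Subalgebra F (MvPolynomial (Fin 4) F)) : Prop :=
  ∀ i < n, ∀ f : MvPolynomial (Fin 4) F, f.IsHomogeneous i → f ∈ invariants p F → f ∈ A

variable (p) in
/-- Polynomials whose degree `n` component has transfer in `A`. -/
def Good (n : ℕ) (A : Subalgebra F (MvPolynomial (Fin 4) F)) :
    Submodule F (MvPolynomial (Fin 4) F) where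
  carrier := {f | trG p F (homogeneousComponent n f) ∈ A}
  add_mem' := by
    intro f g hf hg
    simp only [Set.mem_setOf_eq] at *
    rw [map_add, trG_add]; exact A.add_mem hf hg
  zero_mem' := by
    simp only [Set.mem_setOf_eq]
    rw [map_zero, ← map_zero C, trG_C]; exact A.zero_mem
  smul_mem' := by
    intro c f hf
    simp only [Set.mem_setOf_eq] at *
    rw [map_smul, trG_smul]; exact A.smul_mem hf c

variable {n : ℕ} {A : Subalgebra F (MvPolynomial (Fin 4) F)}

lemma mem_Good {f : MvPolynomial (Fin 4) F} :
    f ∈ Good p n A ↔ trG p F (homogeneousComponent n f) ∈ A := Iff.rfl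

lemma trG_zero : trG p F (0 : MvPolynomial (Fin 4) F) = 0 := by
  have := trG_C (p := p) (0 : F)
  rwa [map_zero] at this

lemma Good_inv_mul (IH : IHyp p n A) {r : MvPolynomial (Fin 4) F} {i : ℕ}
    (hr : r.IsHomogeneous i) (hi : 1 ≤ i) (hR : r ∈ invariants p F)
    (f : MvPolynomial (Fin 4) F) : r * f ∈ Good p n A := by
  rw [mem_Good]
  rcases le_or_gt i n with h | h
  · rw [hc_mul_left F hr n h, trG_mul hR]
    rcases h.lt_or_eq with h1 | h1
    · exact A.mul_mem (IH i h1 r hr hR)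
        (IH (n - i) (by omega) _ (trG_homog (homogeneousComponent_isHomogeneous _ _)) (trG_mem _))
    · rw [h1, Nat.sub_self, homogeneousComponent_zero, trG_C, mul_zero]
      exact A.zero_mem
  · rw [hc_mul_left_zero F hr n h, trG_zero]; exact A.zero_mem

lemma Good_hom {f : MvPolynomial (Fin 4) F} {d : ℕ} (hf : f.IsHomogeneous d) (hd : d ≠ n) :
    f ∈ Good p n A := by
  rw [mem_Good, homogeneousComponent_of_mem hf, if_neg (Ne.symm hd), trG_zero]
  exact A.zero_mem

lemma Good_act {g : Matrix (Fin 2) (Fin 2) (ZMod p)} (hg : g.det = 1)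
    {f : MvPolynomial (Fin 4) F} (hf : f ∈ Good p n A) : act p F g f ∈ Good p n A := by
  rw [mem_Good, hc_act, trG_act hg]; exact hf

lemma exists_pow_ne {m : ℤ} (hm : ¬ ((p : ℤ) - 1) ∣ m) : ∃ w : ZMod p, w ≠ 0 ∧ w ^ m ≠ 1 := by
  obtain ⟨u, hu⟩ := IsCyclic.exists_generator (α := (ZMod p)ˣ)
  refine ⟨u, u.ne_zero, fun h => hm ?_⟩
  have h1 : u ^ m = 1 := by
    apply Units.ext
    rw [Units.val_zpow_eq_zpow_val, h, Units.val_one]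
  have h2 := orderOf_dvd_iff_zpow_eq_one.2 h1
  rw [orderOf_eq_card_of_forall_mem_zpowers hu, Nat.card_eq_fintype_card, ZMod.card_units p] at h2
  have : 1 ≤ p := (Fact.out : p.Prime).one_lt.le
  push_cast [this] at h2
  exact h2

lemma Good_wt {f : MvPolynomial (Fin 4) F} {m : ℤ} (hf : Wt p m f)
    (hm : ¬ ((p : ℤ) - 1) ∣ m) : f ∈ Good p n A := by
  obtain ⟨w, hw, hw1⟩ := exists_pow_ne hm
  rw [mem_Good]
  have h1 := hf w hw
  have h2 := congrArg (homogeneousComponent n) h1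
  rw [hc_act, homogeneousComponent_C_mul] at h2
  have hdet : (!![w, 0; 0, w⁻¹] : Matrix (Fin 2) (Fin 2) (ZMod p)).det = 1 := by
    simp [Matrix.det_fin_two, hw]
  have h3 := congrArg (trG p F) h2
  rw [trG_act hdet, ← smul_eq_C_mul, trG_smul, smul_eq_C_mul] at h3
  set T := trG p F (homogeneousComponent n f)
  have h4 : C (1 - iota p F w ^ m) * T = 0 := by
    rw [map_sub, map_one, sub_mul, one_mul, sub_eq_zero]; exact h3
  have h5 : T = 0 := by
    rcases mul_eq_zero.1 h4 with h | h
    · exfalso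
      rw [C_eq_zero, sub_eq_zero, ← map_zpow₀] at h
      apply hw1
      apply (iota p F).injective
      rw [← h, map_one]
    · exact h
  rw [h5]; exact A.zero_mem

lemma Good_of_PiT {c : MvPolynomial (Fin 4) F}
    (h : PiT (p := p) (homogeneousComponent n (trP p F c)) ∈ A) : c ∈ Good p n A := by
  rw [mem_Good, trG_eq, trP_hc]; exact h

lemma GoodP_mul (IH : IHyp p n A) {r : MvPolynomial (Fin 4) F} {i : ℕ}
    (hr : r.IsHomogeneous i) (hi : 1 ≤ i) (hin : i < n) (hR : r ∈ invariants p F)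
    {h : MvPolynomial (Fin 4) F} (hh : PInv p F h) :
    PiT (p := p) (homogeneousComponent n (r * h)) ∈ A := by
  rw [hc_mul_left F hr n hin.le, PiT_mul hR]
  exact A.mul_mem (IH i hin r hr hR)
    (IH (n - i) (by omega) _ (PiT_homog (homogeneousComponent_isHomogeneous _ _))
      (PiT_mem (hh.hc _)))

/-- The key lemma. -/
lemma Good_key (IH : IHyp p n A) (hn : p + 1 < n) {b r H : MvPolynomial (Fin 4) F} {i : ℕ}
    (hr : r.IsHomogeneous i) (hi : 1 ≤ i) (hin : i < n) (hR : r ∈ invariants p F)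
    (hH : PInv p F H) (hb : phi F (trP p F b) = phi F (r * H)) {j : ℕ} (hj : 1 ≤ j) :
    Npoly p F ^ j * b ∈ Good p n A := by
  obtain ⟨w, hw⟩ := dvd_of_phi hb
  have hwP : PInv p F w := by
    apply PInv.of_mul PInv.X0 (X_ne_zero 0)
    rw [← hw]
    exact (trP_inv b).sub ((PInv.of_inv hR).mul hH)
  obtain ⟨j, rfl⟩ := Nat.exists_eq_add_of_le' hj
  apply Good_of_PiT
  have e : trP p F (Npoly p F ^ (j + 1) * b) =
      r * (Npoly p F ^ (j + 1) * H) + Theta p F * (Npoly p F ^ j * w) := by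
    rw [trP_mul (N_PInv.pow _), Theta]
    linear_combination (Npoly p F) ^ (j + 1) * hw
  rw [e, map_add, PiT_add]
  exact A.add_mem (GoodP_mul IH hr hi hin hR ((N_PInv.pow _).mul hH))
    (GoodP_mul IH Theta_homog (by omega) (by omega) Theta_inv ((N_PInv.pow _).mul hwP))

lemma Good_key_zero (IH : IHyp p n A) (hn : p + 1 < n) {b : MvPolynomial (Fin 4) F}
    (hb : phi F (trP p F b) = 0) {j : ℕ} (hj : 1 ≤ j) :
    Npoly p F ^ j * b ∈ Good p n A := by
  refine Good_key IH hn (isHomogeneous_zero _ _ 1) le_rfl (by omega)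
    (invariants p F).zero_mem (PInv.zero) ?_ hj
  rw [hb, zero_mul, map_zero]

/-- The submodules used in the reduction. -/
def YY (n : ℕ) (A : Subalgebra F (MvPolynomial (Fin 4) F)) (j : ℕ) :
    Submodule F (MvPolynomial (Fin 4) F) :=
  (Good p n A).comap (LinearMap.mulLeft F (Npoly p F ^ j))

lemma mem_YY {j : ℕ} {f : MvPolynomial (Fin 4) F} :
    f ∈ YY (p := p) n A j ↔ Npoly p F ^ j * f ∈ Good p n A := Iff.rfl

lemma YY_inv_mul (IH : IHyp p n A) {r : MvPolynomial (Fin 4) F} {i : ℕ}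
    (hr : r.IsHomogeneous i) (hi : 1 ≤ i) (hR : r ∈ invariants p F) (j : ℕ)
    (f : MvPolynomial (Fin 4) F) : r * f ∈ YY (p := p) n A j := by
  rw [mem_YY, mul_left_comm]; exact Good_inv_mul IH hr hi hR _

lemma YY_X0 (IH : IHyp p n A) {j : ℕ} (hj : 1 ≤ j)
    (f : MvPolynomial (Fin 4) F) : X 0 * f ∈ YY (p := p) n A j := by
  obtain ⟨j, rfl⟩ := Nat.exists_eq_add_of_le' hj
  rw [mem_YY]
  have : Npoly p F ^ (j + 1) * (X 0 * f) = Theta p F * (Npoly p F ^ j * f) := by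
    rw [Theta]; ring
  rw [this]
  exact Good_inv_mul IH Theta_homog (by omega) Theta_inv _

lemma YY_top_k (IH : IHyp p n A) {k : ℕ} (hk : 1 ≤ k) (hk3 : (p - 1) ∣ 3 * k)
    (f : MvPolynomial (Fin 4) F) : f ∈ YY (p := p) n A (k + 1) := by
  have hp1 : 1 ≤ p := (Fact.out : p.Prime).one_lt.le
  have hT : Wt p 0 (Npoly p F ^ k) := by
    refine (N_Wt.pow k).congr ?_
    have := Int.natCast_dvd_natCast.2 hk3
    push_cast [hp1] at this
    rw [sub_zero, mul_comm]; exact this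
  obtain ⟨w, hw⟩ := PiT_dvd (dvd_pow_self _ (by omega)) hT
  rw [mem_YY]
  have e : Npoly p F ^ (k + 1) * f = Npoly p F ^ 1 * (PiT (p := p) (Npoly p F ^ k) * (-f))
      + Npoly p F ^ 1 * (X 0 * (w * f)) := by
    linear_combination (Npoly p F) * f * hw
  rw [e]
  refine Submodule.add_mem _ ?_ ?_
  · exact mem_YY.1 (YY_inv_mul IH (i := p * k) (PiT_homog (N_homog.pow k)) (Nat.mul_pos hp1 hk)
      (PiT_mem (N_PInv.pow k)) 1 (-f))
  · exact mem_YY.1 (YY_X0 IH le_rfl (w * f))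

lemma YY_e (IH : IHyp p n A) {j : ℕ} (hj : 2 ≤ j)
    (f : MvPolynomial (Fin 4) F) : epoly F * f ∈ YY (p := p) n A j := by
  obtain ⟨j, rfl⟩ := Nat.exists_eq_add_of_le' hj
  have hT : Wt p 0 (epoly F * Npoly p F) := (e_Wt.mul N_Wt).congr (by norm_num)
  obtain ⟨w, hw⟩ := PiT_dvd (dvd_mul_left _ _) hT
  rw [mem_YY]
  have e : Npoly p F ^ (j + 2) * (epoly F * f) =
      Npoly p F ^ (j + 1) * (PiT (p := p) (epoly F * Npoly p F) * (-f))
      + Npoly p F ^ (j + 1) * (X 0 * (w * f)) := by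
    linear_combination (Npoly p F) ^ (j + 1) * f * hw
  rw [e]
  refine Submodule.add_mem _ ?_ ?_
  · exact mem_YY.1 (YY_inv_mul IH (i := 3 + p) (PiT_homog (e_homog.mul N_homog)) (by omega)
      (PiT_mem (e_PInv.mul N_PInv)) (j + 1) (-f))
  · exact mem_YY.1 (YY_X0 IH (by omega) (w * f))

end GoodSec

section Reduction

variable {p : ℕ} [Fact p.Prime] {F : Type} [Field F] [CharP F p]

lemma mono_top {Z : Submodule F (MvPolynomial (Fin 4) F)}
    (h : ∀ a b c d : ℕ, (X 0 ^ a * X 1 ^ b * X 2 ^ c * X 3 ^ d : MvPolynomial (Fin 4) F) ∈ Z)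
    (f : MvPolynomial (Fin 4) F) : f ∈ Z := by
  rw [f.as_sum]
  refine Submodule.sum_mem _ fun d _ => ?_
  rw [monomial_eq, ← smul_eq_C_mul, Finsupp.prod_fintype _ _ (by simp), Fin.prod_univ_four]
  exact Z.smul_mem _ (h _ _ _ _)

lemma xi_pow (j : ℕ) : ∃ w : MvPolynomial (Fin 4) F,
    xipoly F ^ j = C (3 ^ j) * X 2 ^ (2 * j) + X 1 * X 3 * w := by
  obtain ⟨w, hw⟩ := sub_dvd_pow_sub_pow (xipoly F) (3 * X 2 ^ 2) j
  refine ⟨-4 * w, ?_⟩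
  have e : (C (3 ^ j) : MvPolynomial (Fin 4) F) = 3 ^ j := by rw [map_pow, map_ofNat]
  rw [e]
  rw [xipoly] at hw ⊢
  rw [mul_pow, ← pow_mul] at hw
  linear_combination hw

/-- `Kp` modulo `X 0` and `X 1 * X 3`. -/
lemma Kp_mod (hp : 3 < p) : ∃ (c : F) (u w : MvPolynomial (Fin 4) F), c ≠ 0 ∧
    Kp p F = X 1 ^ (p - 1) + C c * X 2 ^ (p - 1) + X 0 * u + X 1 * X 3 * w := by
  obtain ⟨u, hu⟩ := sub_phi_dvd (Kp p F)
  rw [phi_Kp hp] at hu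
  obtain ⟨w, hw⟩ := xi_pow (F := F) ((p - 1) / 2)
  obtain ⟨h, hh⟩ := p_odd hp
  refine ⟨- (kap p F (p - 1) * 3 ^ ((p - 1) / 2)), u, - C (kap p F (p - 1)) * w, ?_, ?_⟩
  · rw [neg_ne_zero]
    exact mul_ne_zero (kap_ne hp (by omega) (by omega)) (pow_ne_zero _ (three_ne hp))
  · rw [show 2 * ((p - 1) / 2) = p - 1 by omega] at hw
    rw [hw] at hu
    rw [map_neg, map_mul]
    linear_combination hu

lemma N_mod : ∃ a b c : MvPolynomial (Fin 4) F,
    Npoly p F = X 3 ^ p + X 0 * a + X 1 * b + X 2 * c := by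
  have hN : psi F 3 (Npoly p F) = X 3 ^ p := by
    rw [Npoly_eq, map_prod, Finset.prod_congr rfl (g := fun _ => X 3), Finset.prod_const,
      Finset.card_univ, ZMod.card]
    intro s _
    simp [lin, psi_X]
  have e : psi F 0 (Npoly p F) = Npoly p F := by simp [psi]
  obtain ⟨a, ha⟩ := psi_step 0 (by omega) (Npoly p F)
  obtain ⟨b, hb⟩ := psi_step 1 (by omega) (Npoly p F)
  obtain ⟨c, hc⟩ := psi_step 2 (by omega) (Npoly p F)
  refine ⟨a, b, c, ?_⟩
  rw [e] at ha
  norm_num at ha hb hc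
  rw [hN] at hc
  change _ = X 2 * c at hc
  linear_combination ha + hb + hc

/-- Core of the reduction lemma. -/
lemma RL_core (hp : 3 < p) {Z : Submodule F (MvPolynomial (Fin 4) F)}
    (h0 : ∀ f, X 0 * f ∈ Z) (h1 : ∀ f, X 1 * f ∈ Z) (hN : ∀ f, Npoly p F * f ∈ Z)
    (hK : ∀ f, Kp p F * f ∈ Z)
    (hb : ∀ i ε j, i ≤ p - 1 → ε ≤ 1 → j ≤ (p - 3) / 2 →
      (X 3 ^ i * X 2 ^ ε * xipoly F ^ j : MvPolynomial (Fin 4) F) ∈ Z)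
    (f : MvPolynomial (Fin 4) F) : f ∈ Z := by
  have h2 : ∀ f, X 2 ^ (p - 1) * f ∈ Z := by
    intro f
    obtain ⟨c, u, w, hc, hK'⟩ := Kp_mod (F := F) hp
    have hX1 : (X 1 ^ (p - 1) : MvPolynomial (Fin 4) F) = X 1 * X 1 ^ (p - 2) := by
      rw [← pow_succ']; congr 1; omega
    have e : C c * (X 2 ^ (p - 1) * f) = Kp p F * f - X 1 * (X 1 ^ (p - 2) * f)
      - X 0 * (u * f) - X 1 * (X 3 * w * f) := by
      rw [hK', hX1]; ring
    have : C c * (X 2 ^ (p - 1) * f) ∈ Z := by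
      rw [e]
      exact Z.sub_mem (Z.sub_mem (Z.sub_mem (hK _) (h1 _)) (h0 _)) (h1 _)
    rw [← smul_eq_C_mul] at this
    exact (Z.smul_mem_iff hc).1 this
  have claim : ∀ m, m ≤ p - 1 → ∀ f, X 2 ^ (p - 1 - m) * f ∈ Z := by
    intro m
    induction m with
    | zero => intro _ f; exact h2 f
    | succ m ih =>
      intro hm f
      have ih' := ih (by omega)
      obtain ⟨l, hl⟩ : ∃ l, l = p - 1 - (m + 1) := ⟨_, rfl⟩
      rw [show p - 1 - m = l + 1 by omega] at ih'
      rw [← hl]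
      have h3 : ∀ f, X 2 ^ l * (X 3 ^ p * f) ∈ Z := by
        intro f
        obtain ⟨a, b, c, hN'⟩ := N_mod (p := p) (F := F)
        have e : X 2 ^ l * (X 3 ^ p * f) = Npoly p F * (X 2 ^ l * f) - X 0 * (a * X 2 ^ l * f)
          - X 1 * (b * X 2 ^ l * f) - X 2 ^ (l + 1) * (c * f) := by
          rw [hN']; ring
        rw [e]
        exact Z.sub_mem (Z.sub_mem (Z.sub_mem (hN _) (h0 _)) (h1 _)) (ih' _)
      have h4 : ∀ i, i ≤ p - 1 → X 2 ^ l * X 3 ^ i ∈ Z := by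
        intro i hi
        obtain ⟨h, hh⟩ := p_odd hp
        have hb' := hb i (l % 2) (l / 2) hi (by omega) (by omega)
        obtain ⟨w, hw⟩ := xi_pow (F := F) (l / 2)
        have hl2 : (X 2 ^ l : MvPolynomial (Fin 4) F) = X 2 ^ (2 * (l / 2)) * X 2 ^ (l % 2) := by
          rw [← pow_add]; congr 1; omega
        have e : C ((3 : F) ^ (l / 2)) * (X 2 ^ l * X 3 ^ i) =
            X 3 ^ i * X 2 ^ (l % 2) * xipoly F ^ (l / 2)
            - X 1 * (X 3 * w * X 3 ^ i * X 2 ^ (l % 2)) := by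
          rw [hw, hl2]; ring
        have : C ((3 : F) ^ (l / 2)) * (X 2 ^ l * X 3 ^ i) ∈ Z := by
          rw [e]; exact Z.sub_mem hb' (h1 _)
        rw [← smul_eq_C_mul] at this
        exact (Z.smul_mem_iff (pow_ne_zero _ (three_ne hp))).1 this
      have : f ∈ Z.comap (LinearMap.mulLeft F (X 2 ^ l)) := by
        apply mono_top
        intro a b c d
        change X 2 ^ l * (X 0 ^ a * X 1 ^ b * X 2 ^ c * X 3 ^ d) ∈ Z
        rcases a with _ | a
        · rcases b with _ | b
          · rcases c with _ | c
            · rcases le_or_gt d (p - 1) with hd | hd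
              · have := h4 d hd
                simpa using this
              · obtain ⟨d', rfl⟩ : ∃ d', d = p + d' := ⟨d - p, by omega⟩
                have := h3 (X 3 ^ d')
                simpa [pow_add] using this
            · have := ih' (X 2 ^ c * X 3 ^ d)
              convert this using 1
              ring
          · have := h1 (X 1 ^ b * X 2 ^ c * X 3 ^ d * X 2 ^ l)
            convert this using 1
            ring
        · have := h0 (X 0 ^ a * X 1 ^ b * X 2 ^ c * X 3 ^ d * X 2 ^ l)
          convert this using 1
          ring
      exact this
  have := claim (p - 1) le_rfl f
  simpa using this

/-- The reduction lemma. -/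
lemma RL (hp : 3 < p) {Y : Submodule F (MvPolynomial (Fin 4) F)}
    (h0 : ∀ f, X 0 * f ∈ Y) (hN : ∀ f, Npoly p F * f ∈ Y)
    (hK : ∀ f, Kp p F * f ∈ Y) (Q : ℕ) (hQ : ∀ f, X 1 ^ Q * f ∈ Y)
    (hb : ∀ i ε j q, i ≤ p - 1 → ε ≤ 1 → j ≤ (p - 3) / 2 → q < Q →
      (X 3 ^ i * X 2 ^ ε * xipoly F ^ j * X 1 ^ q : MvPolynomial (Fin 4) F) ∈ Y)
    (f : MvPolynomial (Fin 4) F) : f ∈ Y := by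
  have claim : ∀ m, m ≤ Q → ∀ f, X 1 ^ (Q - m) * f ∈ Y := by
    intro m
    induction m with
    | zero => intro _ f; exact hQ f
    | succ m ih =>
      intro hm f
      have ih' := ih (by omega)
      obtain ⟨q, hq⟩ : ∃ q, q = Q - (m + 1) := ⟨_, rfl⟩
      rw [show Q - m = q + 1 by omega] at ih'
      rw [← hq]
      have : f ∈ Y.comap (LinearMap.mulLeft F (X 1 ^ q)) := by
        apply RL_core hp
        · intro f
          change X 1 ^ q * (X 0 * f) ∈ Y
          rw [mul_left_comm]; exact h0 _
        · intro f
          change X 1 ^ q * (X 1 * f) ∈ Y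
          rw [← mul_assoc, ← pow_succ]; exact ih' _
        · intro f
          change X 1 ^ q * (Npoly p F * f) ∈ Y
          rw [mul_left_comm]; exact hN _
        · intro f
          change X 1 ^ q * (Kp p F * f) ∈ Y
          rw [mul_left_comm]; exact hK _
        · intro i ε j hi hε hj
          change X 1 ^ q * (X 3 ^ i * X 2 ^ ε * xipoly F ^ j) ∈ Y
          rw [mul_comm]; exact hb i ε j q hi hε hj (by omega)
      exact this
  have := claim Q le_rfl f
  simpa using this

lemma D_mod : ∃ w : MvPolynomial (Fin 4) F, Dpoly F = X 1 ^ 2 * xipoly F + X 0 * w := by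
  obtain ⟨w, hw⟩ := sub_phi_dvd (Dpoly F)
  rw [phi_D] at hw
  exact ⟨w, by linear_combination hw⟩

lemma mem_xi {Y : Submodule F (MvPolynomial (Fin 4) F)}
    (h0 : ∀ f, X 0 * f ∈ Y) (hD : ∀ f, Dpoly F * f ∈ Y) (f : MvPolynomial (Fin 4) F) :
    X 1 ^ 2 * xipoly F * f ∈ Y := by
  obtain ⟨w, hw⟩ := D_mod (F := F)
  have e : X 1 ^ 2 * xipoly F * f = Dpoly F * f - X 0 * (w * f) := by rw [hw]; ring
  rw [e]; exact Y.sub_mem (hD _) (h0 _)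

lemma mem_X1_p (hp : 3 < p) {Y : Submodule F (MvPolynomial (Fin 4) F)}
    (h0 : ∀ f, X 0 * f ∈ Y) (hD : ∀ f, Dpoly F * f ∈ Y) (hK : ∀ f, Kp p F * f ∈ Y)
    (f : MvPolynomial (Fin 4) F) : X 1 ^ (p + 1) * f ∈ Y := by
  obtain ⟨u, hu⟩ := sub_phi_dvd (Kp p F)
  rw [phi_Kp hp] at hu
  obtain ⟨h, hh⟩ : ∃ h, (p - 1) / 2 = h + 1 := ⟨(p - 1) / 2 - 1, by omega⟩
  rw [hh] at hu
  have e1 : (X 1 ^ (p + 1) : MvPolynomial (Fin 4) F) = X 1 ^ 2 * X 1 ^ (p - 1) := by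
    rw [← pow_add]; congr 1; omega
  have e : X 1 ^ (p + 1) * f = Kp p F * (X 1 ^ 2 * f) - X 0 * (u * X 1 ^ 2 * f)
      + X 1 ^ 2 * xipoly F * (C (kap p F (p - 1)) * xipoly F ^ h * f) := by
    rw [e1]
    linear_combination - X 1 ^ 2 * f * hu
  rw [e]
  exact Y.add_mem (Y.sub_mem (hK _) (h0 _)) (mem_xi h0 hD _)

lemma RL2 (hp : 3 < p) {Y : Submodule F (MvPolynomial (Fin 4) F)}
    (h0 : ∀ f, X 0 * f ∈ Y) (hN : ∀ f, Npoly p F * f ∈ Y)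
    (hK : ∀ f, Kp p F * f ∈ Y) (hD : ∀ f, Dpoly F * f ∈ Y) (Q : ℕ) (hQ : ∀ f, X 1 ^ Q * f ∈ Y)
    (hb : ∀ i ε j q, i ≤ p - 1 → ε ≤ 1 → j ≤ (p - 3) / 2 → q < Q → (q ≤ 1 ∨ j = 0) →
      (X 3 ^ i * X 2 ^ ε * xipoly F ^ j * X 1 ^ q : MvPolynomial (Fin 4) F) ∈ Y)
    (f : MvPolynomial (Fin 4) F) : f ∈ Y := by
  refine RL hp h0 hN hK Q hQ ?_ f
  intro i ε j q hi hε hj hq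
  by_cases h : q ≤ 1 ∨ j = 0
  · exact hb i ε j q hi hε hj hq h
  · obtain ⟨q', rfl⟩ : ∃ q', q = q' + 2 := ⟨q - 2, by omega⟩
    obtain ⟨j', rfl⟩ : ∃ j', j = j' + 1 := ⟨j - 1, by omega⟩
    have := mem_xi h0 hD (X 3 ^ i * X 2 ^ ε * xipoly F ^ j' * X 1 ^ q')
    convert this using 1
    ring

lemma mem_X1_3 (hp : 3 < p) {Y : Submodule F (MvPolynomial (Fin 4) F)}
    (h0 : ∀ f, X 0 * f ∈ Y) (he : ∀ f, epoly F * f ∈ Y)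
    (f : MvPolynomial (Fin 4) F) : X 1 ^ 3 * f ∈ Y := by
  have e : C (2 : F) * (X 1 ^ 3 * f) = epoly F * f - X 0 * ((X 3 * X 0 - 3 * X 2 * X 1) * f) := by
    rw [epoly, map_ofNat]; ring
  have : C (2 : F) * (X 1 ^ 3 * f) ∈ Y := by
    rw [e]; exact Y.sub_mem (he _) (h0 _)
  rw [← smul_eq_C_mul] at this
  exact (Y.smul_mem_iff (two_ne hp)).1 this

end Reduction

section Cases

variable {p : ℕ} [Fact p.Prime] {F : Type} [Field F] [CharP F p]
variable {n : ℕ} {A : Subalgebra F (MvPolynomial (Fin 4) F)}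

lemma xi_homog : (xipoly F).IsHomogeneous 2 := by
  unfold xipoly
  refine IsHomogeneous.sub ?_ ?_
  · have := (hom_nat (F := F) 3).mul ((isHomogeneous_X F (2 : Fin 4)).pow 2)
    simpa using this
  · have := ((hom_nat (F := F) 4).mul (isHomogeneous_X F (3 : Fin 4))).mul
      (isHomogeneous_X F (1 : Fin 4))
    simpa using this

lemma xi_Wt : Wt p 2 (xipoly F) := by
  unfold xipoly
  refine Wt.sub ?_ ?_
  · exact ((Wt.nat 3).mul (Wt.X2.pow 2)).congr (by norm_num)
  · exact (((Wt.nat 4).mul Wt.X3).mul Wt.X1).congr (by norm_num)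

variable (F) in
/-- The spanning monomials of the reduction. -/
def bb (i ε j q : ℕ) : MvPolynomial (Fin 4) F := X 3 ^ i * X 2 ^ ε * xipoly F ^ j * X 1 ^ q

lemma bb_homog (i ε j q : ℕ) : (bb F i ε j q).IsHomogeneous (i + ε + 2 * j + q) := by
  have := ((((isHomogeneous_X F (3 : Fin 4)).pow i).mul ((isHomogeneous_X F (2 : Fin 4)).pow ε)).mul
    (xi_homog.pow j)).mul ((isHomogeneous_X F (1 : Fin 4)).pow q)
  simpa [bb] using this

lemma bb_Wt (i ε j q : ℕ) : Wt p (3 * i + ε + 2 * j - q) (bb F i ε j q) := by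
  refine ((((Wt.X3.pow i).mul (Wt.X2.pow ε)).mul (xi_Wt.pow j)).mul (Wt.X1.pow q)).congr ?_
  have : (i * 3 + ε * 1 + j * 2 + q * (-1) - (3 * i + ε + 2 * j - q) : ℤ) = 0 := by ring
  rw [this]; exact dvd_zero _

lemma phi_tr_bb (i ε j q : ℕ) : phi F (trP p F (bb F i ε j q)) =
    phi F (trP p F (X 3 ^ i * X 2 ^ ε)) * (xipoly F ^ j * X 1 ^ q) := by
  rw [bb, mul_assoc]
  apply phi_trP_mul
  intro s
  rw [map_mul, map_mul, map_pow, map_pow, map_pow, map_pow, phi_act_xi, phi_act_X1]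

/-- Reduction to the right degree and weight. -/
lemma bb_red {J i ε j q : ℕ} (h : p * J + (i + ε + 2 * j + q) = n →
    ((p : ℤ) - 1) ∣ 3 * J + (3 * i + ε + 2 * j - q) → bb F i ε j q ∈ YY (p := p) n A J) :
    bb F i ε j q ∈ YY (p := p) n A J := by
  by_cases h1 : p * J + (i + ε + 2 * j + q) = n
  · by_cases h2 : ((p : ℤ) - 1) ∣ 3 * J + (3 * i + ε + 2 * j - q)
    · exact h h1 h2
    · rw [mem_YY]
      refine Good_wt ((N_Wt.pow J).mul (bb_Wt i ε j q)) ?_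
      rw [mul_comm]; exact h2
  · rw [mem_YY]
    exact Good_hom ((N_homog.pow J).mul (bb_homog i ε j q)) h1

lemma bb_T3 (hp : 3 < p) (IH : IHyp p n A) (hn : p + 1 < n) {J : ℕ} (hJ : 1 ≤ J) {i : ℕ}
    (hi : i < p - 1) (j q : ℕ) : bb F i 1 j q ∈ YY (p := p) n A J := by
  rw [mem_YY]
  apply Good_key_zero IH hn _ hJ
  rw [phi_tr_bb, pow_one, mul_comm (X 3 ^ i), T3 hp hi, zero_mul]

lemma bb_T1_zero (hp : 3 < p) (IH : IHyp p n A) (hn : p + 1 < n) {J : ℕ} (hJ : 1 ≤ J) {i : ℕ}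
    (hi : i < (p - 1) / 2) (j q : ℕ) : bb F i 0 j q ∈ YY (p := p) n A J := by
  rw [mem_YY]
  apply Good_key_zero IH hn _ hJ
  rw [phi_tr_bb, pow_zero, mul_one, T1_zero hp hi, zero_mul]

lemma bb_T1 (hp : 3 < p) {i : ℕ} (hi : (p - 1) / 2 ≤ i) (hi2 : i < p - 1) (j q : ℕ) :
    phi F (trP p F (bb F i 0 j q)) =
      C (kap p F i) * X 1 ^ (q + (p - 1 - i)) * xipoly F ^ (j + (i - (p - 1) / 2)) := by
  rw [phi_tr_bb, pow_zero, mul_one, T1 hp hi hi2]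
  ring

lemma small_dvd {m x : ℤ} (h : m ∣ x) (h1 : -m < x) (h2 : x < 2 * m) : x = 0 ∨ x = m := by
  obtain ⟨c, rfl⟩ := h
  have hm : 0 < m := by linarith
  have a1 : -1 < c := by nlinarith
  have a2 : c < 2 := by nlinarith
  have : c = 0 ∨ c = 1 := by omega
  rcases this with rfl | rfl
  · left; ring
  · right; ring

lemma small_dvd0 {m x : ℤ} (h : m ∣ x) (h1 : -m < x) (h2 : x < m) : x = 0 := by
  rcases small_dvd h h1 (by linarith) with h | h
  · exact h
  · omega

lemma phi_pow_D (B : ℕ) : phi F (Dpoly F ^ B) = X 1 ^ (2 * B) * xipoly F ^ B := by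
  rw [map_pow, phi_D, mul_pow, ← pow_mul]

/-- The top case `J = k`. -/
lemma case_top (hp : 3 < p) (IH : IHyp p n A) {k : ℕ} (hk : 2 ≤ k) (hk3 : (p - 1) ∣ 3 * k)
    (hn : p * k + 5 ≤ n) (f : MvPolynomial (Fin 4) F) : f ∈ YY (p := p) n A k := by
  have hpk : p * 2 ≤ p * k := Nat.mul_le_mul_left p hk
  have hn1 : p + 1 < n := by omega
  have h0 : ∀ f, X 0 * f ∈ YY (p := p) n A k := YY_X0 IH (by omega)
  have hk3' : ((p : ℤ) - 1) ∣ 3 * k := by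
    have := Int.natCast_dvd_natCast.2 hk3
    have hp1 : 1 ≤ p := by omega
    push_cast [hp1] at this
    exact this
  refine RL2 hp h0 ?_ (YY_inv_mul IH Kp_homog (by omega) Kp_inv k)
    (YY_inv_mul IH D_homog (by omega) D_inv k) 3 (mem_X1_3 hp h0 (YY_e IH hk)) ?_ f
  · intro f
    have := YY_top_k IH (by omega) hk3 f
    rw [mem_YY] at this ⊢
    rwa [← mul_assoc, ← pow_succ]
  · intro i ε j q hi hε hj hq hqj
    change bb F i ε j q ∈ _
    apply bb_red
    intro hdeg hwt
    have hwt := (Int.dvd_add_right hk3').1 hwt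
    obtain ⟨h, hh⟩ := p_odd hp
    have hεc : ε = 0 ∨ ε = 1 := by omega
    rcases hεc with rfl | rfl
    · rcases lt_or_ge i ((p - 1) / 2) with hi1 | hi1
      · exact bb_T1_zero hp IH hn1 (by omega) hi1 j q
      · rcases hi.lt_or_eq with hi2 | hi2
        · have hw2 : ((p : ℤ) - 1) ∣ (3 * i + 2 * j - q) - 2 * (p - 1) := by
            apply dvd_sub
            · simpa using hwt
            · exact dvd_mul_left _ _
          have hcase := small_dvd hw2 (by omega) (by omega)
          rw [mem_YY]
          obtain ⟨B, hB⟩ : ∃ B, B = j + (i - (p - 1) / 2) := ⟨_, rfl⟩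
          obtain ⟨A', hA'⟩ : ∃ A', A' = q + (p - 1 - i) := ⟨_, rfl⟩
          have htr := bb_T1 (F := F) hp hi1 hi2 j q
          rw [← hB, ← hA'] at htr
          rcases hcase with hc | hc
          · have e1 : A' = 2 * B := by omega
            obtain ⟨B', rfl⟩ : ∃ B', B = B' + 1 := ⟨B - 1, by omega⟩
            refine Good_key IH hn1 (r := Dpoly F) (H := C (kap p F i) * Dpoly F ^ B') D_homog
              (by omega) (by omega) D_inv ((PInv.C _).mul ((PInv.of_inv D_inv).pow _)) ?_ (by omega)
            have e2 : Dpoly F * (C (kap p F i) * Dpoly F ^ B') =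
              C (kap p F i) * Dpoly F ^ (B' + 1) := by ring
            rw [e2, map_mul, phi_pow_D, htr, e1, phi_C]; ring
          · obtain ⟨B', hB'⟩ : ∃ B', B = B' + 1 + (p - 1) / 2 := ⟨B - 1 - (p - 1) / 2, by omega⟩
            have e1 : A' = 2 * (B' + 1) := by omega
            have hkne := kap_ne (F := F) hp (i := p - 1) (by omega) (by omega)
            refine Good_key IH hn1 (r := Dpoly F)
              (H := C (kap p F i) * C (kap p F (p - 1))⁻¹ * Dpoly F ^ B' *
                (dpoly F ^ ((p - 1) / 2) - Kp p F)) D_homog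
              (by omega) (by omega) D_inv ((((PInv.C _).mul (PInv.C _)).mul
                ((PInv.of_inv D_inv).pow _)).mul ((d_PInv.pow _).sub (PInv.of_inv Kp_inv)))
                ?_ (by omega)
            have e2 : Dpoly F * (C (kap p F i) * C (kap p F (p - 1))⁻¹ * Dpoly F ^ B' *
                (dpoly F ^ ((p - 1) / 2) - Kp p F)) =
              C (kap p F i) * C (kap p F (p - 1))⁻¹ * Dpoly F ^ (B' + 1) *
                (dpoly F ^ ((p - 1) / 2) - Kp p F) := by ring
            have e3 : (C (kap p F (p - 1))⁻¹ * C (kap p F (p - 1)) : MvPolynomial (Fin 4) F) = 1 := by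
              rw [← map_mul, inv_mul_cancel₀ hkne, map_one]
            have e4 : phi F (dpoly F ^ ((p - 1) / 2) - Kp p F) =
                C (kap p F (p - 1)) * xipoly F ^ ((p - 1) / 2) := by
              rw [map_sub, map_pow, phi_d, phi_Kp hp, ← pow_mul,
                show 2 * ((p - 1) / 2) = p - 1 by omega]
              ring
            rw [e2, map_mul, e4, map_mul, phi_pow_D, map_mul, phi_C, phi_C, htr, e1, hB']
            rw [pow_add (xipoly F)]
            linear_combination (- C (kap p F i) * X 1 ^ (2 * (B' + 1)) * xipoly F ^ (B' + 1) *
              xipoly F ^ ((p - 1) / 2)) * e3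
        · subst hi2
          have hw2 : ((p : ℤ) - 1) ∣ (2 * j - q) := by
            have h1 : (2 * j - q : ℤ) = (3 * ((p - 1 : ℕ) : ℤ) + ((0 : ℕ) : ℤ) + 2 * j - q)
              - 3 * (p - 1) := by
              push_cast [show 1 ≤ p by omega]; ring
            rw [h1]
            exact dvd_sub hwt (dvd_mul_left _ _)
          have := small_dvd0 hw2 (by omega) (by omega)
          have hj0 : j = 0 := by omega
          have hq0 : q = 0 := by omega
          subst hj0 hq0
          rw [mem_YY]
          refine Good_key IH hn1 (r := Kp p F) (H := C (-1)) Kp_homog (by omega) (by omega)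
            Kp_inv (PInv.C _) ?_ (by omega)
          rw [bb, Kp_eq]
          have : (0 : MvPolynomial (Fin 4) F) ^ (p - 1) = 0 := zero_pow (by omega)
          simp [this]
    · rcases hi.lt_or_eq with hi2 | hi2
      · exact bb_T3 hp IH hn1 (by omega) hi2 j q
      · subst hi2
        have hw2 : ((p : ℤ) - 1) ∣ (1 + 2 * j - q) := by
          have h1 : (1 + 2 * j - q : ℤ) = (3 * ((p - 1 : ℕ) : ℤ) + ((1 : ℕ) : ℤ) + 2 * j - q)
            - 3 * (p - 1) := by
            push_cast [show 1 ≤ p by omega]; ring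
          rw [h1]
          exact dvd_sub hwt (dvd_mul_left _ _)
        have := small_dvd0 hw2 (by omega) (by omega)
        have hj0 : j = 0 := by omega
        have hq0 : q = 1 := by omega
        subst hj0 hq0
        rw [mem_YY]
        refine Good_key IH hn1 (r := Lpoly p F) (H := C (-3⁻¹)) L_homog (by omega) (by omega)
          (L_inv hp) (PInv.C _) ?_ (by omega)
        have h4 := T4 (F := F) hp
        apply mul_left_cancel₀ (threeP_ne hp (F := F))
        have e3 : (3 * C (-3⁻¹) : MvPolynomial (Fin 4) F) = -1 := by
          rw [← map_ofNat C 3, ← map_mul, mul_neg, mul_inv_cancel₀ (three_ne hp), map_neg, map_one]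
        rw [phi_tr_bb, pow_zero, one_mul, pow_one, map_mul, phi_C, pow_one, mul_comm (X 3 ^ (p - 1))]
        rw [map_mul, phi_X1] at h4
        linear_combination h4 - phi F (Lpoly p F) * e3

end Cases

section Cases2

variable {p : ℕ} [Fact p.Prime] {F : Type} [Field F] [CharP F p]
variable {n : ℕ} {A : Subalgebra F (MvPolynomial (Fin 4) F)}

lemma YY_N {J : ℕ} (h : ∀ f, f ∈ YY (p := p) n A (J + 1)) (f : MvPolynomial (Fin 4) F) :
    Npoly p F * f ∈ YY (p := p) n A J := by
  have := h f
  rw [mem_YY] at this ⊢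
  rwa [← mul_assoc, ← pow_succ]

/-- Two elements with proportional traces. -/
lemma bb_shift (hp : 3 < p) (IH : IHyp p n A) (hn : p + 1 < n) {J : ℕ} (hJ : 1 ≤ J)
    {i j q i' j' q' : ℕ} (hi : (p - 1) / 2 ≤ i) (hi2 : i < p - 1) (hi' : (p - 1) / 2 ≤ i')
    (hi2' : i' < p - 1) (h1 : q + (p - 1 - i) = q' + (p - 1 - i'))
    (h2 : j + (i - (p - 1) / 2) = j' + (i' - (p - 1) / 2))
    (h : bb F i' 0 j' q' ∈ YY (p := p) n A J) : bb F i 0 j q ∈ YY (p := p) n A J := by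
  have hne := kap_ne (F := F) hp (i := i') (by omega) hi'
  have key : bb F i 0 j q - C (kap p F i * (kap p F i')⁻¹) * bb F i' 0 j' q' ∈
      YY (p := p) n A J := by
    rw [mem_YY]
    apply Good_key_zero IH hn _ hJ
    rw [trP_sub, trP_mul (PInv.C _), map_sub, map_mul, phi_C, bb_T1 hp hi hi2, bb_T1 hp hi' hi2',
      h1, h2]
    have e : (C (kap p F i * (kap p F i')⁻¹) * C (kap p F i') : MvPolynomial (Fin 4) F)
      = C (kap p F i) := by
      rw [← map_mul, mul_assoc, inv_mul_cancel₀ hne, mul_one]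
    linear_combination - X 1 ^ (q' + (p - 1 - i')) * xipoly F ^ (j' + (i' - (p - 1) / 2)) * e
  have h3 := (YY (p := p) n A J).smul_mem (kap p F i * (kap p F i')⁻¹) h
  rw [smul_eq_C_mul] at h3
  have := Submodule.add_mem _ key h3
  rwa [sub_add_cancel] at this

/-- The case `J = k - 1` with `J ≥ 2`. -/
lemma case_sub (hp : 3 < p) (IH : IHyp p n A) {J : ℕ} (hJ : 2 ≤ J)
    (hk3 : (p - 1) ∣ 3 * (J + 1))
    (hn : p * (J + 1) + 5 ≤ n) (hY : ∀ f, f ∈ YY (p := p) n A (J + 1))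
    (f : MvPolynomial (Fin 4) F) : f ∈ YY (p := p) n A J := by
  have hpk : p * 2 ≤ p * J := Nat.mul_le_mul_left p hJ
  have hpJ : p * (J + 1) = p * J + p := by ring
  have hn1 : p + 1 < n := by omega
  have h0 : ∀ f, X 0 * f ∈ YY (p := p) n A J := YY_X0 IH (by omega)
  have hD : ∀ f, Dpoly F * f ∈ YY (p := p) n A J := YY_inv_mul IH D_homog (by omega) D_inv J
  have hk3' : ((p : ℤ) - 1) ∣ 3 * (J + 1) := by
    have := Int.natCast_dvd_natCast.2 hk3
    have hp1 : 1 ≤ p := by omega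
    push_cast [hp1] at this
    exact this
  refine RL2 hp h0 (YY_N hY) (YY_inv_mul IH Kp_homog (by omega) Kp_inv J)
    hD 3 (mem_X1_3 hp h0 (YY_e IH hJ)) ?_ f
  intro i ε j q hi hε hj hq hqj
  change bb F i ε j q ∈ _
  apply bb_red
  intro hdeg hwt
  have hw1 : ((p : ℤ) - 1) ∣ (3 * i + ε + 2 * j - q - 3) := by
    have e : (3 * i + ε + 2 * j - q - 3 : ℤ) = 3 * J + (3 * i + ε + 2 * j - q) - 3 * (J + 1) := by
      ring
    rw [e]
    exact dvd_sub hwt hk3'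
  obtain ⟨h, hh⟩ := p_odd hp
  have hεc : ε = 0 ∨ ε = 1 := by omega
  rcases hεc with rfl | rfl
  · rcases lt_or_ge i ((p - 1) / 2) with hi1 | hi1
    · exact bb_T1_zero hp IH hn1 (by omega) hi1 j q
    · have hqc : q = 0 ∨ q = 1 := by omega
      obtain ⟨u, hu⟩ : ∃ u, i + u = p - 1 := ⟨p - 1 - i, by omega⟩
      have hw2 : ((p : ℤ) - 1) ∣ (2 * j - q - 3 - 3 * u) := by
        have e0 : (i : ℤ) = p - 1 - u := by omega
        have e : (2 * j - q - 3 - 3 * u : ℤ) =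
            3 * i + ((0 : ℕ) : ℤ) + 2 * j - q - 3 - 3 * (p - 1) := by
          rw [e0]; push_cast; ring
        rw [e]
        exact dvd_sub hw1 (dvd_mul_left _ _)
      have hev : ((2 : ℤ)) ∣ (2 * j - q - 3 - 3 * u) :=
        dvd_trans ⟨h, by omega⟩ hw2
      have hmem : ∀ a b, bb F a 0 (b + 1) 2 ∈ YY (p := p) n A J := by
        intro a b
        have := mem_xi h0 hD (X 3 ^ a * xipoly F ^ b)
        convert this using 1
        rw [bb]; ring
      rcases hqc with rfl | rfl
      · rcases lt_or_ge u 3 with hu3 | hu3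
        · exfalso
          interval_cases u
          · omega
          · have := small_dvd0 hw2 (by omega) (by omega)
            omega
          · omega
        · obtain ⟨j', rfl⟩ : ∃ j', j = j' + 3 := ⟨j - 3, by omega⟩
          exact bb_shift hp IH hn1 (by omega) hi1 (by omega) (i' := i + 2) (j' := j' + 1) (q' := 2)
            (by omega) (by omega) (by omega) (by omega) (hmem _ _)
      · rcases lt_or_ge u 2 with hu3 | hu3
        · exfalso
          interval_cases u
          · have := small_dvd0 hw2 (by omega) (by omega)
            omega
          · omega
        · obtain ⟨j', rfl⟩ : ∃ j', j = j' + 2 := ⟨j - 2, by omega⟩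
          exact bb_shift hp IH hn1 (by omega) hi1 (by omega) (i' := i + 1) (j' := j' + 1) (q' := 2)
            (by omega) (by omega) (by omega) (by omega) (hmem _ _)
  · rcases hi.lt_or_eq with hi2 | hi2
    · exact bb_T3 hp IH hn1 (by omega) hi2 j q
    · exfalso
      subst hi2
      have hw2 : ((p : ℤ) - 1) ∣ (2 * j - q - 2) := by
        have e : (2 * j - q - 2 : ℤ) =
            3 * ((p - 1 : ℕ) : ℤ) + ((1 : ℕ) : ℤ) + 2 * j - q - 3 - 3 * (p - 1) := by
          push_cast [show 1 ≤ p by omega]; ring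
        rw [e]
        exact dvd_sub hw1 (dvd_mul_left _ _)
      have := small_dvd0 hw2 (by omega) (by omega)
      omega

/-- The middle cases. -/
lemma case_mid (hp : 3 < p) (IH : IHyp p n A) {J : ℕ} (hJ : 1 ≤ J)
    (hn : p * (J + 2) + 5 ≤ n) (hY : ∀ f, f ∈ YY (p := p) n A (J + 1))
    (f : MvPolynomial (Fin 4) F) : f ∈ YY (p := p) n A J := by
  have hpJ : p * (J + 2) = p * J + 2 * p := by ring
  have h0 : ∀ f, X 0 * f ∈ YY (p := p) n A J := YY_X0 IH (by omega)
  have hD : ∀ f, Dpoly F * f ∈ YY (p := p) n A J := YY_inv_mul IH D_homog (by omega) D_inv J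
  have hK : ∀ f, Kp p F * f ∈ YY (p := p) n A J := YY_inv_mul IH Kp_homog (by omega) Kp_inv J
  refine RL2 hp h0 (YY_N hY) hK hD (p + 1) (mem_X1_p hp h0 hD hK) ?_ f
  intro i ε j q hi hε hj hq hqj
  change bb F i ε j q ∈ _
  apply bb_red
  intro hdeg hwt
  exfalso
  omega

/-- The exceptional case. -/
lemma case_seven (hp7 : p = 7) (IH : IHyp p n A) 
    (hn : p * 2 + 5 ≤ n) (hY : ∀ f, f ∈ YY (p := p) n A 2)
    (f : MvPolynomial (Fin 4) F) : f ∈ YY (p := p) n A 1 := by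
  have hp : 3 < p := by omega
  have h0 : ∀ f, X 0 * f ∈ YY (p := p) n A 1 := YY_X0 IH (by omega)
  have hD : ∀ f, Dpoly F * f ∈ YY (p := p) n A 1 := YY_inv_mul IH D_homog (by omega) D_inv 1
  have hK : ∀ f, Kp p F * f ∈ YY (p := p) n A 1 := YY_inv_mul IH Kp_homog (by omega) Kp_inv 1
  refine RL2 hp h0 (YY_N hY) hK hD (p + 1) (mem_X1_p hp h0 hD hK) ?_ f
  intro i ε j q hi hε hj hq hqj
  change bb F i ε j q ∈ _
  apply bb_red
  intro hdeg hwt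
  have hεc : ε = 0 ∨ ε = 1 := by omega
  have hp1 : (p : ℤ) - 1 = 6 := by omega
  rw [hp1] at hwt
  rcases hεc with rfl | rfl
  · exfalso
    push_cast at hwt
    omega
  · rcases hi.lt_or_eq with hi2 | hi2
    · exact bb_T3 hp IH (by omega) (by omega) hi2 j q
    · exfalso
      push_cast at hwt
      omega

lemma YY_one (hp : 3 < p) (IH : IHyp p n A) {k : ℕ} (hk : 2 ≤ k) (hk3 : (p - 1) ∣ 3 * k)
    (hn : p * k + 5 ≤ n) (f : MvPolynomial (Fin 4) F) : f ∈ YY (p := p) n A 1 := by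
  have claim : ∀ m, m ≤ k - 1 → ∀ f, f ∈ YY (p := p) n A (k - m) := by
    intro m
    induction m with
    | zero => intro _; exact case_top hp IH hk hk3 hn
    | succ m ih =>
      intro hm
      have ih' := ih (by omega)
      obtain ⟨J, hJ⟩ : ∃ J, J = k - (m + 1) := ⟨_, rfl⟩
      rw [show k - m = J + 1 by omega] at ih'
      rw [← hJ]
      rcases m with _ | m
      · have hkJ : k = J + 1 := by omega
        subst hkJ
        rcases (show 1 ≤ J by omega).lt_or_eq with h | h
        · exact case_sub hp IH h hk3 hn ih'
        · subst h
          have h6 := Nat.le_of_dvd (by omega) hk3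
          have : p = 7 := by
            have : p ≤ 7 := by omega
            interval_cases p
            · exact absurd (Fact.out : Nat.Prime 4) (by norm_num)
            · omega
            · exact absurd (Fact.out : Nat.Prime 6) (by norm_num)
            · rfl
          exact case_seven this IH hn ih'
      · refine case_mid hp IH (by omega) ?_ ih'
        have : p * (J + 2) ≤ p * k := Nat.mul_le_mul_left p (by omega)
        omega
  have := claim (k - 1) le_rfl f
  rwa [show k - (k - 1) = 1 by omega] at this

end Cases2

section Final

variable {p : ℕ} [Fact p.Prime] {F : Type} [Field F] [CharP F p]
variable {n : ℕ} {A : Subalgebra F (MvPolynomial (Fin 4) F)}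

variable (p) in
/-- Representatives of the points of the projective line. -/
def pt (t : Option (ZMod p)) : ZMod p × ZMod p :=
  match t with
  | none => (0, 1)
  | some s => (1, s)

variable (p F) in
/-- The linear forms. -/
def ell (t : Option (ZMod p)) : MvPolynomial (Fin 4) F := lin p F (pt p t).1 (pt p t).2

lemma prod_ell : ∏ t, ell p F t = Theta p F := by
  rw [Fintype.prod_option, Theta, Npoly_eq]
  congr 1
  exact lin_01 p F

lemma pt_ne (t : Option (ZMod p)) : pt p t ≠ 0 := by
  rcases t with _ | s <;> simp [pt]

lemma pt_det {t t' : Option (ZMod p)} (h : t ≠ t') :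
    (pt p t').1 * (pt p t).2 - (pt p t').2 * (pt p t).1 ≠ 0 := by
  rcases t with _ | s <;> rcases t' with _ | s'
  · simp at h
  · simp [pt]
  · simp [pt]
  · simp only [pt, one_mul, mul_one]
    intro h2
    apply h
    rw [sub_eq_zero] at h2
    rw [h2]

lemma Theta_ne : Theta p F ≠ 0 := mul_ne_zero (X_ne_zero 0) N_ne

lemma ell_ne (t : Option (ZMod p)) : ell p F t ≠ 0 := by
  intro h
  apply Theta_ne (p := p) (F := F)
  rw [← prod_ell]
  exact Finset.prod_eq_zero (Finset.mem_univ t) h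

lemma act_surj {g : Matrix (Fin 2) (Fin 2) (ZMod p)} (hg : g.det = 1)
    (f : MvPolynomial (Fin 4) F) : ∃ f', act p F g f' = f := by
  refine ⟨act p F g.adjugate f, ?_⟩
  rw [act_mul, Matrix.adjugate_mul, hg, one_smul, act_one]

lemma act_N_eq (t : Option (ZMod p)) :
    act p F (gv p (pt p t)) (Npoly p F) = ∏ u ∈ Finset.univ.erase t, ell p F u := by
  apply mul_left_cancel₀ (ell_ne t)
  rw [Finset.mul_prod_erase _ _ (Finset.mem_univ t), prod_ell]
  have h := (mem_inv p F).1 (Theta_inv (p := p) (F := F)) _ (gv_det (pt_ne t))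
  conv_rhs => rw [← h, Theta, map_mul, act_X0_lin, gv_10, gv_11]
  rfl

lemma ell_prod_homog (S : Finset (Option (ZMod p))) :
    (∏ u ∈ S, ell p F u).IsHomogeneous S.card := by
  have := IsHomogeneous.prod S (fun u => ell p F u) (fun _ => 1) (fun u _ => lin_homog _ _)
  simpa using this

/-- Modulo `X 0`, `X 3`, `Dpoly` and `Kp` only monomials of small degree remain. -/
lemma small_top (hp : 3 < p) {Z : Submodule F (MvPolynomial (Fin 4) F)}
    (h0 : ∀ f, X 0 * f ∈ Z) (h3 : ∀ f, X 3 * f ∈ Z) (hD : ∀ f, Dpoly F * f ∈ Z)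
    (hK : ∀ f, Kp p F * f ∈ Z)
    (hs : ∀ x y, x + y ≤ p + 1 → (X 1 ^ x * X 2 ^ y : MvPolynomial (Fin 4) F) ∈ Z)
    (f : MvPolynomial (Fin 4) F) : f ∈ Z := by
  have hD' : ∀ f, X 1 ^ 2 * X 2 ^ 2 * f ∈ Z := by
    intro f
    have e : C (3 : F) * (X 1 ^ 2 * X 2 ^ 2 * f) = Dpoly F * f + X 3 * (4 * X 1 ^ 3 * f)
        - X 0 * ((- 4 * X 2 ^ 3 + 6 * X 3 * X 2 * X 1 - X 3 ^ 2 * X 0) * f) := by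
      rw [Dpoly, map_ofNat]; ring
    have : C (3 : F) * (X 1 ^ 2 * X 2 ^ 2 * f) ∈ Z := by
      rw [e]; exact Z.sub_mem (Z.add_mem (hD _) (h3 _)) (h0 _)
    rw [← smul_eq_C_mul] at this
    exact (Z.smul_mem_iff (three_ne hp)).1 this
  obtain ⟨c, u, w, hc, hK'⟩ := Kp_mod (F := F) hp
  have hm : ∀ x y, (X 1 ^ x * X 2 ^ y : MvPolynomial (Fin 4) F) ∈ Z := by
    intro x y
    rcases le_or_gt (x + y) (p + 1) with h | h
    · exact hs x y h
    · by_cases hxy : 2 ≤ x ∧ 2 ≤ y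
      · obtain ⟨x', rfl⟩ := Nat.exists_eq_add_of_le hxy.1
        obtain ⟨y', rfl⟩ := Nat.exists_eq_add_of_le hxy.2
        have := hD' (X 1 ^ x' * X 2 ^ y')
        convert this using 1
        ring
      · have hp2 : (X 1 ^ (p - 1) : MvPolynomial (Fin 4) F) = X 1 ^ 2 * X 1 ^ (p - 3) := by
          rw [← pow_add]; congr 1; omega
        have hp3 : (X 2 ^ (p - 1) : MvPolynomial (Fin 4) F) = X 2 ^ 2 * X 2 ^ (p - 3) := by
          rw [← pow_add]; congr 1; omega
        rcases lt_or_ge y 2 with hy | hy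
        · obtain ⟨x', rfl⟩ : ∃ x', x = 2 + x' + (p - 1) := ⟨x - 2 - (p - 1), by omega⟩
          have e : (X 1 ^ (2 + x' + (p - 1)) * X 2 ^ y : MvPolynomial (Fin 4) F) =
              Kp p F * (X 1 ^ (2 + x') * X 2 ^ y)
              - X 1 ^ 2 * X 2 ^ 2 * (C c * X 2 ^ (p - 3) * X 1 ^ x' * X 2 ^ y)
              - X 0 * (u * X 1 ^ (2 + x') * X 2 ^ y)
              - X 3 * (X 1 * w * X 1 ^ (2 + x') * X 2 ^ y) := by
            rw [hK', pow_add (X 1) (2 + x'), hp3]; ring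
          rw [e]
          exact Z.sub_mem (Z.sub_mem (Z.sub_mem (hK _) (hD' _)) (h0 _)) (h3 _)
        · obtain ⟨y', rfl⟩ : ∃ y', y = 2 + y' + (p - 1) := ⟨y - 2 - (p - 1), by omega⟩
          have e : C c * (X 1 ^ x * X 2 ^ (2 + y' + (p - 1)) : MvPolynomial (Fin 4) F) =
              Kp p F * (X 1 ^ x * X 2 ^ (2 + y'))
              - X 1 ^ 2 * X 2 ^ 2 * (X 1 ^ (p - 3) * X 1 ^ x * X 2 ^ y')
              - X 0 * (u * X 1 ^ x * X 2 ^ (2 + y'))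
              - X 3 * (X 1 * w * X 1 ^ x * X 2 ^ (2 + y')) := by
            rw [hK', pow_add (X 2) (2 + y'), hp2]; ring
          have : C c * (X 1 ^ x * X 2 ^ (2 + y' + (p - 1)) : MvPolynomial (Fin 4) F) ∈ Z := by
            rw [e]
            exact Z.sub_mem (Z.sub_mem (Z.sub_mem (hK _) (hD' _)) (h0 _)) (h3 _)
          rw [← smul_eq_C_mul] at this
          exact (Z.smul_mem_iff hc).1 this
  apply mono_top
  intro a x y d
  rcases a with _ | a
  · rcases d with _ | d
    · simpa using hm x y
    · have := h3 (X 1 ^ x * X 2 ^ y * X 3 ^ d)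
      convert this using 1
      ring
  · have := h0 (X 0 ^ a * X 1 ^ x * X 2 ^ y * X 3 ^ d)
    convert this using 1
    ring

lemma Good_prod (hp : 3 < p) (IH : IHyp p n A) (hn : 2 * p < n)
    (hN : ∀ f, Npoly p F * f ∈ Good p n A) (m : ℕ) :
    ∀ S : Finset (Option (ZMod p)), S.card + (m + 1) = p + 1 → ∀ f : MvPolynomial (Fin 4) F,
      (∏ u ∈ S, ell p F u) * f ∈ Good p n A := by
  have hcard : Fintype.card (Option (ZMod p)) = p + 1 := by
    rw [Fintype.card_option, ZMod.card]
  induction m with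
  | zero =>
    intro S hS f
    obtain ⟨t, ht⟩ : ∃ t, t ∉ S := by
      by_contra hcon
      push Not at hcon
      have : S = Finset.univ := Finset.eq_univ_iff_forall.2 hcon
      rw [this, Finset.card_univ] at hS
      omega
    have hSe : S = Finset.univ.erase t := by
      apply Finset.eq_of_subset_of_card_le
      · intro u hu
        rw [Finset.mem_erase]
        exact ⟨fun h => ht (h ▸ hu), Finset.mem_univ _⟩
      · rw [Finset.card_erase_of_mem (Finset.mem_univ t), Finset.card_univ]; omega
    rw [hSe, ← act_N_eq]
    have hdet := gv_det (pt_ne t)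
    obtain ⟨f', rfl⟩ := act_surj hdet f
    rw [← map_mul]
    exact Good_act hdet (hN f')
  | succ m ih =>
    intro S hS f
    obtain ⟨t, ht⟩ : ∃ t, t ∉ S := by
      by_contra hcon
      push Not at hcon
      have : S = Finset.univ := Finset.eq_univ_iff_forall.2 hcon
      rw [this, Finset.card_univ] at hS
      omega
    obtain ⟨t', ht'⟩ : ∃ t', t' ∉ insert t S := by
      by_contra hcon
      push Not at hcon
      have : insert t S = Finset.univ := Finset.eq_univ_iff_forall.2 hcon
      have h2 := Finset.card_insert_of_notMem ht
      rw [this, Finset.card_univ] at h2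
      omega
    have htt : t ≠ t' := fun h => ht' (h ▸ Finset.mem_insert_self _ _)
    have ht'S : t' ∉ S := fun h => ht' (Finset.mem_insert_of_mem h)
    have hΔ := pt_det htt
    set Δ := (pt p t').1 * (pt p t).2 - (pt p t').2 * (pt p t).1 with hΔdef
    obtain ⟨g, hg⟩ : ∃ g : Matrix (Fin 2) (Fin 2) (ZMod p), g =
      !![Δ⁻¹ * (pt p t').1, Δ⁻¹ * (pt p t').2; (pt p t).1, (pt p t).2] := ⟨_, rfl⟩
    have hdet : g.det = 1 := by
      rw [hg, Matrix.det_fin_two_of, mul_assoc, mul_assoc, ← mul_sub, ← hΔdef, inv_mul_cancel₀ hΔ]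
    have g0 : act p F g (X 0) = ell p F t := by
      rw [act_X0_lin, hg]; rfl
    have g3 : act p F g (X 3) = C (iota p F Δ⁻¹) ^ 3 * ell p F t' := by
      rw [act_X3_lin, hg, ell, ← lin_smul]; rfl
    obtain ⟨f', rfl⟩ := act_surj hdet f
    have hZ : f' ∈ (Good p n A).comap ((LinearMap.mulLeft F (∏ u ∈ S, ell p F u)).comp
        (act p F g).toLinearMap) := by
      apply small_top hp
      · intro f
        change (∏ u ∈ S, ell p F u) * act p F g (X 0 * f) ∈ Good p n A
        have := ih (insert t S) (by rw [Finset.card_insert_of_notMem ht]; omega) (act p F g f)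
        rw [Finset.prod_insert ht] at this
        rw [map_mul, g0]
        convert this using 1
        ring
      · intro f
        change (∏ u ∈ S, ell p F u) * act p F g (X 3 * f) ∈ Good p n A
        have := ih (insert t' S) (by rw [Finset.card_insert_of_notMem ht'S]; omega)
          (C (iota p F Δ⁻¹) ^ 3 * act p F g f)
        rw [Finset.prod_insert ht'S] at this
        rw [map_mul, g3]
        convert this using 1
        ring
      · intro f
        change (∏ u ∈ S, ell p F u) * act p F g (Dpoly F * f) ∈ Good p n A
        rw [map_mul, (mem_inv p F).1 D_inv g hdet, mul_left_comm]
        exact Good_inv_mul IH D_homog (by omega) D_inv _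
      · intro f
        change (∏ u ∈ S, ell p F u) * act p F g (Kp p F * f) ∈ Good p n A
        rw [map_mul, (mem_inv p F).1 Kp_inv g hdet, mul_left_comm]
        exact Good_inv_mul IH Kp_homog (by omega) Kp_inv _
      · intro x y hxy
        change (∏ u ∈ S, ell p F u) * act p F g (X 1 ^ x * X 2 ^ y) ∈ Good p n A
        have h1 : (X 1 ^ x * X 2 ^ y : MvPolynomial (Fin 4) F).IsHomogeneous (x + y) := by
          have := ((isHomogeneous_X F (1 : Fin 4)).pow x).mul ((isHomogeneous_X F (2 : Fin 4)).pow y)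
          simpa using this
        refine Good_hom ((ell_prod_homog S).mul (act_isHomogeneous p F g h1)) ?_
        omega
    exact hZ

lemma Good_top (hp : 3 < p) (IH : IHyp p n A) {k : ℕ} (hk : 2 ≤ k) (hk3 : (p - 1) ∣ 3 * k)
    (hn : p * k + 5 ≤ n) (f : MvPolynomial (Fin 4) F) : f ∈ Good p n A := by
  have h2 : p * 2 ≤ p * k := Nat.mul_le_mul_left p hk
  have hN : ∀ f, Npoly p F * f ∈ Good p n A := by
    intro f
    have := YY_one hp IH hk hk3 hn f
    rwa [mem_YY, pow_one] at this
  have := Good_prod hp IH (by omega) hN p ∅ (by simp) f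
  simpa using this

lemma main_step (hp : 3 < p) (IH : IHyp p n A) {k : ℕ} (hk : 2 ≤ k) (hk3 : (p - 1) ∣ 3 * k)
    (hn : p * k + 5 ≤ n) {f : MvPolynomial (Fin 4) F} (hf : f.IsHomogeneous n)
    (hfR : f ∈ invariants p F) : f ∈ A := by
  have hp1 : 1 ≤ p := by omega
  have htr : ∀ c : MvPolynomial (Fin 4) F, c.IsHomogeneous n → trG p F c ∈ A := by
    intro c hc
    have := Good_top hp IH hk hk3 hn c
    rwa [mem_Good, homogeneousComponent_of_mem hc, if_pos rfl] at this
  have hpk : 0 < p * k := Nat.mul_pos hp1 (by omega)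
  obtain ⟨c, b, h1, h2, h3⟩ := step0 hp k (by omega) hf (PInv.of_inv hfR)
  have hT : Wt p 0 (Npoly p F ^ k) := by
    refine (N_Wt.pow k).congr ?_
    have := Int.natCast_dvd_natCast.2 hk3
    push_cast [hp1] at this
    rw [sub_zero, mul_comm]; exact this
  have h4 := PiT_torus_trP (N_PInv.pow k) hT.zero_inv
  obtain ⟨c1, hc1⟩ : ∃ c1, PiT (p := p) (Npoly p F ^ k) = - Npoly p F ^ k + trP p F c1 := ⟨_, h4⟩
  have hNh : (Npoly p F ^ k).IsHomogeneous (p * k) := N_homog.pow k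
  have hMh : (PiT (p := p) (Npoly p F ^ k)).IsHomogeneous (p * k) := PiT_homog hNh
  have hMR := PiT_mem (N_PInv.pow k (p := p) (F := F))
  set M := PiT (p := p) (Npoly p F ^ k)
  -- f is minus its relative transfer
  have e : f = trP p F (c + c1 * b) + M * (- b) := by
    rw [trP_add, mul_comm c1, trP_mul h3, h1]
    linear_combination b * hc1
  have e2 : f = trP p F (homogeneousComponent n (c + c1 * b)) + M * (- b) := by
    have h5 := congrArg (homogeneousComponent n) e
    have h6 : (M * (-b)).IsHomogeneous n := by
      have := hMh.mul h2.neg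
      rwa [Nat.add_sub_cancel' (by omega)] at this
    rw [map_add, homogeneousComponent_of_mem hf, if_pos rfl, homogeneousComponent_of_mem h6,
      if_pos rfl, ← trP_hc] at h5
    exact h5
  have e3 : f = - (trG p F (homogeneousComponent n (c + c1 * b)) + M * PiT (p := p) (- b)) := by
    rw [trG_eq, ← PiT_mul hMR, ← PiT_add, ← e2, PiT_inv_neg hfR, neg_neg]
  rw [e3]
  refine A.neg_mem (A.add_mem (htr _ (homogeneousComponent_isHomogeneous _ _)) (A.mul_mem ?_ ?_))
  · exact IH (p * k) (by omega) _ hMh hMR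
  · exact IH (n - p * k) (by omega) _ (PiT_homog h2.neg) (PiT_mem h3.neg)

/-- Generation in degree at most `p * k + 4`. -/
lemma gen_bound (hp : 3 < p) {k : ℕ} (hk : 2 ≤ k) (hk3 : (p - 1) ∣ 3 * k) {β : ℕ}
    (hβ : p * k + 4 ≤ β) :
    Algebra.adjoin F {f : MvPolynomial (Fin 4) F |
        f ∈ invariants p F ∧ ∃ n ≤ β, f.IsHomogeneous n} = invariants p F := by
  apply le_antisymm
  · apply Algebra.adjoin_le
    intro f hf
    exact hf.1
  · set A := Algebra.adjoin F {f : MvPolynomial (Fin 4) F |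
        f ∈ invariants p F ∧ ∃ n ≤ β, f.IsHomogeneous n} with hA
    have key : ∀ n, ∀ f : MvPolynomial (Fin 4) F, f.IsHomogeneous n → f ∈ invariants p F →
        f ∈ A := by
      intro n
      induction n using Nat.strong_induction_on with
      | _ n ih =>
        intro f hf hfR
        rcases le_or_gt n β with h | h
        · exact Algebra.subset_adjoin ⟨hfR, n, h, hf⟩
        · exact main_step hp (fun i hi g hg hgR => ih i hi g hg hgR) hk hk3 (by omega) hf hfR
    intro f hf
    rw [← sum_homogeneousComponent f]
    exact A.sum_mem fun i _ => key i _ (homogeneousComponent_isHomogeneous _ _) (inv_hc hf i)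

end Final

/-- `F[V]^{SL₂(F_p)}` is generated as an `F`-algebra by its homogeneous
elements of degree at most `β(p)`, where `β(p) = p² - p + 4` if `p ≡ -1 (mod 3)` and
`β(p) = (p² - p + 12)/3` if `p ≡ 1 (mod 3)`; in particular the Noether number of
`F[V]^{SL₂(F_p)}` is bounded above by `β(p)`. -/
theorem noether_bound (p : ℕ) [Fact p.Prime] (hp : 3 < p)
    (F : Type) [Field F] [CharP F p] :
    Algebra.adjoin F {f : MvPolynomial (Fin 4) F |
        f ∈ invariants p F ∧
        ∃ n ≤ (if p % 3 = 1 then (p ^ 2 - p + 12) / 3 else p ^ 2 - p + 4),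
          f.IsHomogeneous n} = invariants p F := by
  have hp1 : p ^ 2 - p = p * (p - 1) := by rw [Nat.mul_sub, mul_one, sq]
  by_cases h : p % 3 = 1
  · have hk : 3 * ((p - 1) / 3) = p - 1 := by omega
    have hp4 : p ≠ 4 := by
      rintro rfl
      exact absurd (Fact.out : Nat.Prime 4) (by norm_num)
    refine gen_bound hp (k := (p - 1) / 3) (by omega) (by rw [hk]) ?_
    rw [if_pos h, hp1, Nat.le_div_iff_mul_le (by norm_num)]
    have h2 : p * (p - 1) = p * (3 * ((p - 1) / 3)) := by rw [hk]
    rw [h2]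
    apply le_of_eq
    ring
  · refine gen_bound hp (k := p - 1) (by omega) (dvd_mul_left _ _) ?_
    rw [if_neg h, hp1]

end
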